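/- arXiv:1112.0156 — 12 statements merged into one kernel-verified Lean document; each statement's English description precedes it below -/
import Mathlib

section
/- For every integer n ≥ 1, the Narayana polynomials satisfy the recurrence C_n(q) = (1-q)·C_{n-1}(q) + q·Σ_{i=0}^{n-1} C_i(q)·C_{n-1-i}(q), as an identity of polynomials in q. -/
open Polynomial Finset

/-- The Narayana polynomial `C_n(q)`, with `C_0 = 1` and
`C_n(q) = ∑_{k=1}^n (1/n)·binom(n,k-1)·binom(n,k)·q^(k-1)` for `n ≥ 1`. -/
noncomputable def narayana (n : ℕ) : Polynomial ℚ :=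
  if n = 0 then 1
  else ∑ k ∈ Finset.Icc 1 n,
    Polynomial.C ((n.choose (k - 1) * n.choose k : ℚ) / n) * Polynomial.X ^ (k - 1)

/-- The ratio of consecutive binomial coefficients. -/
theorem cast_choose_succ_right (m j : ℕ) :
    ((m.choose (j + 1) : ℕ) : ℚ) = m.choose j * (m - j) / (j + 1) := by
  rw [eq_div_iff (by positivity)]
  have h := Nat.choose_succ_right_eq m j
  rcases le_or_gt j m with hj | hj
  · rw [← Nat.cast_sub hj]
    exact_mod_cast h
  · simp [Nat.choose_eq_zero_of_lt hj, Nat.choose_eq_zero_of_lt (Nat.lt_succ_of_lt hj)]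

theorem coeff_narayana_succ (n k : ℕ) :
    (narayana (n + 1)).coeff k =
      ((n + 1).choose k * (n + 1).choose (k + 1) : ℚ) / (n + 1) := by
  have h : narayana (n + 1) = ∑ k ∈ Finset.range (n + 1),
      Polynomial.C (((n + 1).choose k * (n + 1).choose (k + 1) : ℚ) / (n + 1)) * X ^ k := by
    rw [narayana, if_neg (Nat.succ_ne_zero n), ← Finset.Ico_add_one_right_eq_Icc,
      Finset.sum_Ico_eq_sum_range]
    refine Finset.sum_congr (by simp) fun i _ => ?_
    simp [add_comm 1 i]
  rw [h, finsetSum_coeff]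
  simp only [coeff_C_mul_X_pow]
  rw [Finset.sum_ite_eq]
  split_ifs with hk
  · rfl
  · rw [Nat.choose_eq_zero_of_lt (k := k + 1) (by simp at hk; omega)]
    simp

theorem coeff_natCast_mul_narayana (m k : ℕ) :
    ((m : ℚ[X]) * narayana m).coeff k = (m.choose k * m.choose (k + 1) : ℚ) := by
  rw [← map_natCast Polynomial.C, coeff_C_mul]
  cases m with
  | zero => simp
  | succ m =>
    rw [coeff_narayana_succ]
    push_cast
    field_simp

/-- The linear three-term recurrence for the Narayana polynomials. -/
theorem narayana_three_term (m : ℕ) :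
    ((m + 3 : ℕ) : ℚ[X]) * narayana (m + 2) =
      ((2 * m + 3 : ℕ) : ℚ[X]) * ((1 + X) * narayana (m + 1)) -
        (1 - X) ^ 2 * ((m : ℚ[X]) * narayana m) := by
  have e1 : (1 + X) * narayana (m + 1) = narayana (m + 1) + narayana (m + 1) * X := by ring
  have e2 : (1 - X) ^ 2 * ((m : ℚ[X]) * narayana m) =
      (m : ℚ[X]) * narayana m - Polynomial.C 2 * ((m : ℚ[X]) * narayana m * X) +
        (m : ℚ[X]) * narayana m * X * X := by
    rw [show (Polynomial.C 2 : ℚ[X]) = 2 from rfl]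
    ring
  rw [e1, e2]
  ext k
  rw [← map_natCast Polynomial.C (m + 3), ← map_natCast Polynomial.C (2 * m + 3)]
  rcases k with _ | _ | j
  · simp only [coeff_sub, coeff_add, coeff_C_mul, coeff_mul_X_zero, coeff_natCast_mul_narayana,
      coeff_narayana_succ, Nat.choose_succ_succ', cast_choose_succ_right, Nat.choose_zero_right]
    push_cast [cast_choose_succ_right, Nat.choose_zero_right]
    field_simp
    ring
  · simp only [coeff_sub, coeff_add, coeff_C_mul, coeff_mul_X_zero, coeff_mul_X,
      coeff_natCast_mul_narayana,
      coeff_narayana_succ, Nat.choose_succ_succ', cast_choose_succ_right, Nat.choose_zero_right]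
    push_cast [cast_choose_succ_right, Nat.choose_zero_right]
    field_simp
    ring
  · simp only [coeff_sub, coeff_add, coeff_C_mul, coeff_mul_X,
      coeff_natCast_mul_narayana, coeff_narayana_succ, Nat.choose_succ_succ']
    push_cast [cast_choose_succ_right]
    field_simp
    ring

/-- A power series with vanishing constant term solving `D * E' = D' * E` is zero. -/
theorem PowerSeries.eq_zero_of_mul_derivative_eq {R : Type*} [CommRing R] [IsDomain R] [CharZero R]
    {D E : PowerSeries R} (hD : constantCoeff D = 1) (hE : constantCoeff E = 0)
    (h : D * derivative R E = derivative R D * E) : E = 0 := by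
  obtain ⟨u, hu⟩ := (isUnit_iff_constantCoeff.2 (hD ▸ isUnit_one) : IsUnit D).exists_right_inv
  have hD0 : D ≠ 0 := by
    rintro rfl
    simp at hD
  have hd := congrArg (derivative R) hu
  simp only [Derivation.leibniz, smul_eq_mul, Derivation.map_one_eq_zero] at hd
  have hEu : E * u = 0 := by
    refine derivative.ext (mul_left_cancel₀ (pow_ne_zero 2 hD0) ?_) (by simp [hE])
    simp only [Derivation.leibniz, smul_eq_mul, map_zero, mul_zero]
    linear_combination (D * derivative R E) * hu + D * E * hd + h - E * derivative R D * hu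
  linear_combination D * hEu - E * hu

/-- If `D' = 2 * T` and `D * S' = T * S`, then `S` is a square root of `D`. -/
theorem PowerSeries.sq_eq_of_mul_derivative_eq {R : Type*} [CommRing R] [IsDomain R] [CharZero R]
    {D S T : PowerSeries R} (hD : constantCoeff D = 1) (hS : constantCoeff S = 1)
    (hT : derivative R D = 2 * T) (h : D * derivative R S = T * S) : S ^ 2 = D := by
  refine sub_eq_zero.1 (eq_zero_of_mul_derivative_eq hD (by simp [hD, hS]) ?_)
  rw [pow_two, map_sub, Derivation.leibniz, smul_eq_mul, hT]
  linear_combination 2 * S * h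

/-- The generating function of the Narayana polynomials. -/
noncomputable def narayanaSeries : PowerSeries ℚ[X] :=
  PowerSeries.mk narayana

/-- The discriminant of the quadratic equation for the generating function. -/
noncomputable def narayanaDisc : PowerSeries ℚ[X] :=
  1 - PowerSeries.C (2 * (1 + X)) * PowerSeries.X +
    PowerSeries.C ((1 - X) ^ 2) * PowerSeries.X * PowerSeries.X

/-- The square root of the discriminant. -/
noncomputable def narayanaSqrt : PowerSeries ℚ[X] :=
  1 - PowerSeries.C (1 - X) * PowerSeries.X -
    PowerSeries.C (2 * X) * (narayanaSeries * PowerSeries.X)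

theorem derivative_narayanaDisc :
    PowerSeries.derivative ℚ[X] narayanaDisc =
      2 * (PowerSeries.C ((1 - X) ^ 2) * PowerSeries.X - PowerSeries.C (1 + X)) := by
  simp only [narayanaDisc, map_add, map_sub, Derivation.leibniz, smul_eq_mul,
    Derivation.map_one_eq_zero, PowerSeries.derivative_C, PowerSeries.derivative_X, map_mul]
  rw [show (PowerSeries.C (2 : ℚ[X])) = 2 from map_ofNat _ 2]
  ring

theorem narayana_zero : narayana 0 = 1 := by simp [narayana]

theorem narayana_one : narayana 1 = 1 := by simp [narayana]

theorem coeff_narayanaSqrt_zero : PowerSeries.coeff 0 narayanaSqrt = 1 := by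
  simp [narayanaSqrt]

theorem coeff_narayanaSqrt_one : PowerSeries.coeff 1 narayanaSqrt = -(1 + X) := by
  have : PowerSeries.coeff 1 narayanaSqrt = 0 - (1 - X) - 2 * X * narayana 0 := by
    have h := PowerSeries.coeff_succ_mul_X 0 narayanaSeries
    rw [zero_add, narayanaSeries, PowerSeries.coeff_mk] at h
    simp only [narayanaSqrt, LinearMap.map_sub, PowerSeries.coeff_C_mul, PowerSeries.coeff_one_X,
      PowerSeries.coeff_one, narayanaSeries, h]
    simp
  rw [this, narayana_zero]
  ring

theorem coeff_narayanaSqrt_add_two (n : ℕ) :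
    PowerSeries.coeff (n + 2) narayanaSqrt = -(2 * X * narayana (n + 1)) := by
  simp only [narayanaSqrt, LinearMap.map_sub, PowerSeries.coeff_C_mul,
    PowerSeries.coeff_one, PowerSeries.coeff_succ_mul_X, narayanaSeries, PowerSeries.coeff_mk]
  simp

theorem narayanaDisc_mul_derivative_narayanaSqrt :
    narayanaDisc * PowerSeries.derivative ℚ[X] narayanaSqrt =
      (PowerSeries.C ((1 - X) ^ 2) * PowerSeries.X - PowerSeries.C (1 + X)) * narayanaSqrt := by
  set S := narayanaSqrt with hS
  set S' := PowerSeries.derivative ℚ[X] S with hS'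
  have e1 : narayanaDisc * S' = S' - PowerSeries.C (2 * (1 + X)) * (S' * PowerSeries.X) +
      PowerSeries.C ((1 - X) ^ 2) * (S' * PowerSeries.X * PowerSeries.X) := by
    rw [narayanaDisc]
    ring
  have e2 : (PowerSeries.C ((1 - X) ^ 2) * PowerSeries.X - PowerSeries.C (1 + X)) * S =
      PowerSeries.C ((1 - X) ^ 2) * (S * PowerSeries.X) - PowerSeries.C (1 + X) * S := by ring
  rw [e1, e2]
  ext1 n
  have c0 := coeff_narayanaSqrt_zero
  have c1 := coeff_narayanaSqrt_one
  have c2 := coeff_narayanaSqrt_add_two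
  rw [← hS] at c0 c1 c2
  rcases n with _ | _ | _ | m
  · simp only [LinearMap.map_sub, LinearMap.map_add, PowerSeries.coeff_C_mul,
      PowerSeries.coeff_zero_mul_X, hS', PowerSeries.coeff_derivative, c0, zero_add, c1]
    push_cast
    ring
  · simp only [LinearMap.map_sub, LinearMap.map_add, PowerSeries.coeff_C_mul,
      PowerSeries.coeff_zero_mul_X, PowerSeries.coeff_succ_mul_X, hS',
      PowerSeries.coeff_derivative, c0, zero_add, c1,
      Nat.reduceAdd, c2 0, narayana_one]
    push_cast
    ring
  · have h := narayana_three_term 0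
    simp only [zero_add, narayana_zero, narayana_one] at h
    simp only [LinearMap.map_sub, LinearMap.map_add, PowerSeries.coeff_C_mul,
      PowerSeries.coeff_succ_mul_X, hS', PowerSeries.coeff_derivative, zero_add, c1,
      Nat.reduceAdd, c2 0, c2 1, narayana_one]
    push_cast at h ⊢
    linear_combination (-2 * X) * h
  · have h := narayana_three_term (m + 1)
    simp only [LinearMap.map_sub, LinearMap.map_add, PowerSeries.coeff_C_mul,
      PowerSeries.coeff_succ_mul_X, hS', PowerSeries.coeff_derivative, c2]
    push_cast at h ⊢
    linear_combination (-2 * X) * h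

theorem narayanaSqrt_sq : narayanaSqrt ^ 2 = narayanaDisc := by
  refine PowerSeries.sq_eq_of_mul_derivative_eq ?_ ?_ derivative_narayanaDisc
    narayanaDisc_mul_derivative_narayanaSqrt
  · simp [narayanaDisc]
  · simp [narayanaSqrt]

/-- The quadratic functional equation of the generating function. -/
theorem narayanaSeries_eq :
    narayanaSeries = 1 + PowerSeries.C (1 - X) * (narayanaSeries * PowerSeries.X) +
      PowerSeries.C X * (narayanaSeries * narayanaSeries * PowerSeries.X) := by
  have h := narayanaSqrt_sq
  have hne : (PowerSeries.C (4 * X) * PowerSeries.X : PowerSeries ℚ[X]) ≠ 0 := by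
    refine mul_ne_zero ?_ PowerSeries.X_ne_zero
    exact (map_ne_zero_iff _ PowerSeries.C_injective).2
      (mul_ne_zero (OfNat.ofNat_ne_zero 4) X_ne_zero)
  refine mul_left_cancel₀ hne ?_
  rw [narayanaSqrt, narayanaDisc] at h
  simp only [map_mul, map_sub, map_add, map_pow, map_one, map_ofNat] at h ⊢
  linear_combination -h

theorem narayana_recurrence (n : ℕ) (hn : 1 ≤ n) :
    narayana n =
      (1 - Polynomial.X) * narayana (n - 1) +
        Polynomial.X * ∑ i ∈ Finset.range n, narayana i * narayana (n - 1 - i) := by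
  obtain ⟨m, rfl⟩ := Nat.exists_eq_add_of_le' hn
  have h := congrArg (PowerSeries.coeff (m + 1)) narayanaSeries_eq
  simp only [LinearMap.map_add, PowerSeries.coeff_C_mul, PowerSeries.coeff_succ_mul_X,
    narayanaSeries, PowerSeries.coeff_mk, PowerSeries.coeff_one] at h
  rw [PowerSeries.coeff_mul, Finset.Nat.sum_antidiagonal_eq_sum_range_succ_mk] at h
  simpa using h
end

section
/- For every integer r ≥ 1, q·C_r(q) = (1/(r+1))·Σ_{m=0}^{r} (q-1)^m · binom(r+1,m) · binom(2r-m,r), as an identity of polynomials in q. -/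
open Polynomial Finset

/-- A weighted form of Vandermonde's identity. -/
theorem sum_choose_mul_choose_mul_choose (m d : ℕ) (h : 1 ≤ m + d) :
    ∑ j ∈ Finset.range (m + d + 1),
        (m + d + 1).choose j * j.choose m * (m + d - 1).choose (m + d - j) =
      (m + d + 1).choose m * (2 * (m + d) - m).choose (m + d) := by
  rw [add_assoc m d 1, Finset.sum_range_add, Finset.sum_eq_zero, zero_add]
  · have hsymm : (2 * (m + d) - m).choose (m + d) = ((d + 1) + (m + d - 1)).choose d := by
      rw [← Nat.choose_symm (by lia)]
      congr 1 <;> lia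
    rw [hsymm, Nat.add_choose_eq (d + 1) (m + d - 1) d, Finset.Nat.sum_antidiagonal_eq_sum_range_succ_mk, Finset.mul_sum]
    refine Finset.sum_congr rfl fun i hi => ?_
    have hi' := Finset.mem_range.1 hi
    rw [Nat.choose_mul (Nat.le_add_right m i), mul_assoc]
    congr 3 <;> lia
  · intro j hj
    rw [Nat.choose_eq_zero_of_lt (Finset.mem_range.1 hj)]
    simp

theorem choose_mul_choose_div_eq (n i : ℕ) (hi : i ≤ n) :
    ((n + 1).choose i * (n + 1).choose (i + 1) : ℚ) / (n + 1) =
      ((n + 2 : ℚ))⁻¹ * ((n + 2).choose (i + 1) * n.choose (n - i)) := by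
  rw [Nat.choose_symm hi]
  have h₁ : ((n + 2) * (n + 1).choose i : ℚ) = (n + 2).choose (i + 1) * (i + 1) := by
    exact_mod_cast Nat.add_one_mul_choose_eq (n + 1) i
  have h₂ : ((n + 1) * n.choose i : ℚ) = (n + 1).choose (i + 1) * (i + 1) := by
    exact_mod_cast Nat.add_one_mul_choose_eq n i
  have h₃ : (i + 1 : ℚ) ≠ 0 := by positivity
  have h₄ : (n + 1 : ℚ) ≠ 0 := by positivity
  have h₅ : (n + 2 : ℚ) ≠ 0 := by positivity
  field_simp
  apply mul_right_cancel₀ h₃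
  linear_combination ((n + 1).choose (i + 1) * (i + 1) : ℚ) * h₁ -
    ((n + 2).choose (i + 1) * (i + 1) : ℚ) * h₂

theorem X_mul_narayana_succ (n : ℕ) :
    Polynomial.X * narayana (n + 1) =
      Polynomial.C ((n + 2 : ℚ)⁻¹) *
        ∑ j ∈ Finset.range (n + 2),
          Polynomial.C ((n + 2).choose j * n.choose (n + 1 - j) : ℚ) * Polynomial.X ^ j := by
  rw [narayana, if_neg n.succ_ne_zero, Finset.sum_range_succ',
    ← Finset.Ico_add_one_right_eq_Icc, Finset.sum_Ico_eq_sum_range]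
  simp only [Nat.sub_zero, Nat.choose_succ_self, Nat.cast_zero, mul_zero, map_zero, zero_mul,
    add_zero, Finset.mul_sum, Nat.add_sub_cancel, add_comm 1]
  refine Finset.sum_congr rfl fun i hi => ?_
  have hi' := Finset.mem_range.1 hi
  rw [Nat.add_sub_add_right, Nat.cast_add_one,
    choose_mul_choose_div_eq n i (by lia), map_mul]
  ring

theorem X_pow_eq_sum_X_sub_one_pow (j N : ℕ) (h : j < N) :
    (Polynomial.X : Polynomial ℚ) ^ j =
      ∑ m ∈ Finset.range N, (Polynomial.X - 1) ^ m * Polynomial.C (j.choose m : ℚ) := by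
  conv_lhs => rw [← sub_add_cancel (Polynomial.X : Polynomial ℚ) 1, add_pow]
  simp only [one_pow, mul_one, map_natCast]
  refine Finset.sum_subset (Finset.range_subset_range.2 h) fun m _ hm => ?_
  rw [Nat.choose_eq_zero_of_lt (by simpa using hm)]
  simp

theorem narayana_formula (r : ℕ) (hr : 1 ≤ r) :
    Polynomial.X * narayana r =
      Polynomial.C ((r + 1 : ℚ)⁻¹) *
        ∑ m ∈ Finset.range (r + 1),
          (Polynomial.X - 1) ^ m *
            Polynomial.C (((r + 1).choose m * (2 * r - m).choose r : ℚ)) := by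
  obtain ⟨n, rfl⟩ : ∃ n, r = n + 1 := ⟨r - 1, by lia⟩
  rw [X_mul_narayana_succ]
  congr 1
  · congr 2
    push_cast
    ring
  rw [Finset.sum_congr rfl fun j hj => by
    rw [X_pow_eq_sum_X_sub_one_pow j (n + 2) (Finset.mem_range.1 hj), Finset.mul_sum],
    Finset.sum_comm]
  refine Finset.sum_congr rfl fun m hm => ?_
  obtain ⟨d, hd⟩ := Nat.exists_eq_add_of_le (Nat.lt_succ_iff.1 (Finset.mem_range.1 hm))
  have key := sum_choose_mul_choose_mul_choose m d (by lia)
  rw [← hd] at key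
  rw [← Nat.cast_mul, ← key, Nat.cast_sum, map_sum, Finset.mul_sum]
  refine Finset.sum_congr rfl fun j _ => ?_
  simp only [Nat.add_sub_cancel, Nat.cast_mul, map_mul]
  ring
end

section
/- For all integers r ≥ 1 and 0 ≤ k ≤ r, Σ_{m=k+1}^{r} (-1)^{m-1} · binom(r+1,m) · binom(2r-m,r) = (-1)^k · binom(r-1,k) · binom(2r-k,r). -/
open Finset

theorem choose_mul_choose_add_choose_mul_choose (k d : ℕ) :
    (k + d).choose k * (k + 2 * d + 2).choose (k + d + 1) +
        (k + d).choose (k + 1) * (k + 2 * d + 1).choose (k + d + 1) =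
      (k + d + 2).choose (k + 1) * (k + 2 * d + 1).choose (k + d + 1) := by
  have h₁ := Nat.choose_mul_succ_eq (k + 2 * d + 1) (k + d + 1)
  have h₂ := Nat.choose_mul_succ_eq (k + d) k
  have h₃ : (k + d + 2).choose (k + 1) =
      (k + d + 1).choose k + ((k + d).choose k + (k + d).choose (k + 1)) := by
    rw [← Nat.choose_succ_succ', ← Nat.choose_succ_succ']
  rw [show k + 2 * d + 1 + 1 - (k + d + 1) = d + 1 by omega] at h₁
  rw [show k + d + 1 - k = d + 1 by omega] at h₂
  rw [h₃]
  apply Nat.eq_of_mul_eq_mul_left (Nat.succ_pos d)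
  simp only [Nat.succ_eq_add_one]
  linear_combination (k + 2 * d + 1).choose (k + d + 1) * h₂ - (k + d).choose k * h₁

theorem partial_alternating_sum_choose (r k : ℕ) (hr : 1 ≤ r) (hk : k ≤ r) :
    ∑ m ∈ Finset.Icc (k + 1) r,
      (-1 : ℤ) ^ (m - 1) * ((r + 1).choose m) * ((2 * r - m).choose r) =
      (-1 : ℤ) ^ k * ((r - 1).choose k) * ((2 * r - k).choose r) := by
  induction hk using Nat.decreasingInduction with
  | self => simp [Nat.choose_eq_zero_of_lt (Nat.sub_lt hr one_pos)]
  | of_succ k hk ih =>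
    rw [← Finset.insert_Icc_add_one_left_eq_Icc hk, Finset.sum_insert (by simp), ih]
    obtain ⟨d, rfl⟩ := Nat.exists_eq_add_of_lt hk
    have h := choose_mul_choose_add_choose_mul_choose k d
    zify at h
    rw [show 2 * (k + d + 1) - (k + 1) = k + 2 * d + 1 by omega,
      show 2 * (k + d + 1) - k = k + 2 * d + 2 by omega]
    simp only [Nat.add_sub_cancel, pow_succ]
    linear_combination -(-1 : ℤ) ^ k * h
end

section
/- For every integer r ≥ 1, C_r(q) = (1/(r+1))·Σ_{m=0}^{r-1} (q-1)^m · binom(r-1,m) · binom(2r-m,r), as an identity of polynomials in q. -/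
open Polynomial Finset

theorem sum_choose_mul_choose_mul_choose_succ (m d : ℕ) :
    ∑ k ∈ range (m + d + 1), k.choose m * ((m + d + 1).choose k * (m + d + 1).choose (k + 1)) =
      (m + d + 1).choose m * (d + 1 + (m + d + 1)).choose d := by
  rw [add_assoc m d 1, sum_range_add, sum_eq_zero, zero_add,
    Nat.add_choose_eq (d + 1) (m + (d + 1)) d,
    Finset.Nat.sum_antidiagonal_eq_sum_range_succ_mk, mul_sum]
  · refine sum_congr rfl fun j hj => ?_
    have hj : j ≤ d := by simpa [Nat.lt_succ_iff] using hj
    have h₁ := Nat.choose_mul (n := m + (d + 1)) (k := m + j) (s := m) (by omega)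
    rw [Nat.add_sub_cancel_left, Nat.add_sub_cancel_left] at h₁
    have h₂ : (m + (d + 1)).choose (m + j + 1) = (m + (d + 1)).choose (d - j) :=
      Nat.choose_symm_of_eq_add (by omega)
    dsimp only
    rw [h₂, ← mul_assoc, mul_comm ((m + j).choose m), h₁, mul_assoc]
  · intro k hk
    rw [Nat.choose_eq_zero_of_lt (mem_range.mp hk), zero_mul]

theorem sum_choose_mul_narayana_coeff {n m : ℕ} (hm : m ≤ n) :
    ∑ k ∈ range (n + 1),
        (k.choose m : ℚ) * (((n + 1).choose k * (n + 1).choose (k + 1) : ℚ) / (n + 1)) =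
      (n + 2 : ℚ)⁻¹ * (n.choose m * (2 * (n + 1) - m).choose (n + 1)) := by
  obtain ⟨d, rfl⟩ := Nat.exists_eq_add_of_le hm
  have key := congrArg (Nat.cast (R := ℚ)) (sum_choose_mul_choose_mul_choose_succ m d)
  have h₁ := congrArg (Nat.cast (R := ℚ)) (Nat.choose_mul_succ_eq (m + d) m)
  have h₂ := congrArg (Nat.cast (R := ℚ))
    (Nat.choose_succ_right_eq (d + 1 + (m + d + 1)) (m + d + 1))
  rw [Nat.choose_symm_of_eq_add (show d + 1 + (m + d + 1) = (m + d + 1 + 1) + d by omega)] at h₂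
  rw [show m + d + 1 - m = d + 1 by omega] at h₁
  rw [show d + 1 + (m + d + 1) - (m + d + 1) = d + 1 by omega] at h₂
  rw [show 2 * (m + d + 1) - m = d + 1 + (m + d + 1) by omega]
  simp only [← mul_div_assoc, ← sum_div]
  push_cast at key h₁ h₂ ⊢
  rw [key]
  have hd : (d + 1 : ℚ) ≠ 0 := by positivity
  have hn : (m + d + 1 : ℚ) ≠ 0 := by positivity
  have hn' : (m + d + 2 : ℚ) ≠ 0 := by positivity
  field_simp
  apply mul_left_cancel₀ hd
  linear_combination ((m + d + 1).choose m * (d + 1) : ℚ) * h₂ -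
    ((d + 1) * (d + 1 + (m + d + 1)).choose (m + d + 1) : ℚ) * h₁

theorem X_pow_eq_sum_X_sub_one_pow_s4 {R : Type*} [CommRing R] {n k : ℕ} (hk : k ≤ n) :
    (X : R[X]) ^ k = ∑ m ∈ range (n + 1), (X - 1) ^ m * C (k.choose m : R) := by
  conv_lhs => rw [← sub_add_cancel (X : R[X]) 1, add_pow]
  simp only [one_pow, mul_one, map_natCast]
  refine sum_subset (range_subset_range.mpr (by omega)) fun m _ hm => ?_
  rw [Nat.choose_eq_zero_of_lt (by simpa using hm), Nat.cast_zero, mul_zero]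

theorem narayana_formula' (r : ℕ) (hr : 1 ≤ r) :
    narayana r =
      Polynomial.C ((r + 1 : ℚ)⁻¹) *
        ∑ m ∈ Finset.range r,
          (Polynomial.X - 1) ^ m *
            Polynomial.C (((r - 1).choose m * (2 * r - m).choose r : ℚ)) := by
  obtain ⟨n, rfl⟩ := Nat.exists_eq_add_of_le' hr
  rw [narayana, if_neg n.succ_ne_zero, ← Ico_add_one_right_eq_Icc, sum_Ico_eq_sum_range]
  simp only [Nat.add_sub_cancel_left, Nat.add_sub_cancel]
  calc
    _ = ∑ k ∈ range (n + 1), ∑ m ∈ range (n + 1), (X - 1) ^ m *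
          C ((k.choose m : ℚ) * (((n + 1).choose k * (n + 1).choose (k + 1) : ℚ) / (n + 1))) := by
      refine sum_congr rfl fun k hk => ?_
      rw [X_pow_eq_sum_X_sub_one_pow_s4 (Nat.lt_succ_iff.mp (mem_range.mp hk)), mul_sum]
      refine sum_congr rfl fun m _ => ?_
      rw [C_mul, add_comm 1 k]
      push_cast
      ring
    _ = _ := by
      rw [sum_comm, mul_sum]
      refine sum_congr rfl fun m hm => ?_
      rw [← mul_sum, ← map_sum,
        sum_choose_mul_narayana_coeff (Nat.lt_succ_iff.mp (mem_range.mp hm)), C_mul]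
      push_cast
      rw [add_assoc (n : ℚ) 1 1, one_add_one_eq_two]
      ring
end

section
/- For every integer r ≥ 1, C_r(q) = Σ_{m=0}^{r} q^m · (1-q)^{r-m} · binom(r+m,2m) · Cat_m, as an identity of polynomials in q, where Cat_m is the m-th Catalan number. -/
open Polynomial Finset

theorem coeff_one_add_C_mul_X_pow {R : Type*} [CommRing R] (q : R) (r j : ℕ) :
    ((1 + C q * X) ^ r : R[X]).coeff j = r.choose j * q ^ j := by
  have h : ((1 + C q * X) ^ r : R[X]) = ((1 + X) ^ r : R[X]).comp (C q * X) := by simp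
  rw [h, comp_C_mul_X_coeff, coeff_one_add_X_pow]

theorem sum_choose_mul_choose_add_mul_pow {R : Type*} [CommRing R] (q : R) (n : ℕ) :
    ∑ m ∈ range (n + 2),
        q ^ m * (1 - q) ^ (n + 1 - m) * ((n + 1).choose m * (n + 1 + m).choose (m + 1)) =
      ∑ j ∈ range (n + 1), ((n + 1).choose j * (n + 1).choose (j + 1)) * q ^ j := by
  trans ((1 + C q * X) ^ (n + 1) * (1 + X) ^ (n + 1) : R[X]).coeff n
  · have h : (1 + C q * X : R[X]) = C q * (1 + X) + C (1 - q) := by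
      simp only [C_sub, C_1]
      ring
    rw [h, add_pow, sum_mul, finsetSum_coeff]
    refine sum_congr rfl fun m _ => ?_
    have h₂ : ((C q * (1 + X)) ^ m * C (1 - q) ^ (n + 1 - m) * ((n + 1).choose m : R[X]) *
        (1 + X) ^ (n + 1) : R[X]) =
        C (q ^ m * (1 - q) ^ (n + 1 - m) * (n + 1).choose m) * (1 + X) ^ (n + 1 + m) := by
      simp only [C_mul, C_pow, C_eq_natCast, mul_pow, pow_add]
      ring
    rw [h₂, coeff_C_mul, coeff_one_add_X_pow, mul_assoc, mul_assoc, mul_assoc,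
      Nat.choose_symm_of_eq_add (show n + 1 + m = (m + 1) + n by ring)]
  · rw [coeff_mul, Nat.sum_antidiagonal_eq_sum_range_succ_mk]
    refine sum_congr rfl fun j hj => ?_
    have hj : j ≤ n := by simpa [Nat.lt_succ_iff] using hj
    rw [coeff_one_add_C_mul_X_pow, coeff_one_add_X_pow,
      Nat.choose_symm_of_eq_add (show n + 1 = (n - j) + (j + 1) by omega)]
    ring

theorem mul_choose_two_mul_mul_catalan {r m : ℕ} (hr : 1 ≤ r) (h : m ≤ r) :
    r * ((r + m).choose (2 * m) * catalan m) = r.choose m * (r + m).choose (m + 1) := by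
  obtain ⟨d, rfl⟩ := Nat.exists_eq_add_of_le h
  obtain ⟨n, hn⟩ : ∃ n, m + d = n + 1 := ⟨m + d - 1, by omega⟩
  have h₁ := Nat.add_choose_mul_factorial_mul_factorial d (2 * m)
  have h₂ := Nat.add_choose_mul_factorial_mul_factorial d m
  have h₃ := Nat.add_choose_mul_factorial_mul_factorial n (m + 1)
  have h₄ := Nat.add_choose_mul_factorial_mul_factorial m m
  have h₅ : (m + 1) * catalan m = (m + m).choose m := by
    rw [succ_mul_catalan_eq_centralBinom, Nat.centralBinom_eq_two_mul_choose, two_mul]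
  rw [show d + 2 * m = m + d + m by ring] at h₁
  rw [show n + (m + 1) = m + d + m by omega] at h₃
  rw [← h₅, ← two_mul] at h₄
  rw [add_comm d m] at h₂
  have h₆ : (m + d).factorial = (m + d) * n.factorial := by rw [hn, Nat.factorial_succ]
  rw [Nat.factorial_succ] at h₃
  have hpos : 0 < m.factorial * d.factorial * ((m + 1) * m.factorial) * n.factorial := by positivity
  apply Nat.eq_of_mul_eq_mul_right hpos
  calc _ = (m + d) * n.factorial * ((m + d + m).choose (2 * m) *
          d.factorial * ((m + 1) * catalan m * m.factorial * m.factorial)) := by ring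
    _ = (m + d).factorial * (m + d + m).factorial := by rw [h₄, h₁, h₆]
    _ = _ := by rw [← h₂, ← h₃]; ring

theorem narayana_catalan_expansion (r : ℕ) (hr : 1 ≤ r) :
    narayana r =
      ∑ m ∈ Finset.range (r + 1),
        Polynomial.X ^ m * (1 - Polynomial.X) ^ (r - m) *
          Polynomial.C (((r + m).choose (2 * m) * catalan m : ℚ)) := by
  have hr₀ : (r : ℚ) ≠ 0 := by positivity
  have hC : (C (r : ℚ)) ≠ 0 := by simpa using hr₀
  apply mul_left_cancel₀ hC
  trans ∑ m ∈ range (r + 1), (X : ℚ[X]) ^ m * (1 - X) ^ (r - m) *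
      ((r.choose m : ℚ[X]) * ((r + m).choose (m + 1) : ℚ[X]))
  · obtain ⟨n, rfl⟩ := Nat.exists_eq_add_of_le' hr
    rw [sum_choose_mul_choose_add_mul_pow, narayana, if_neg (by omega), mul_sum,
      ← Finset.Ico_succ_right_eq_Icc, Finset.sum_Ico_eq_sum_range]
    refine sum_congr (by simp) fun j _ => ?_
    rw [← mul_assoc, ← C_mul, mul_div_cancel₀ _ hr₀, Nat.add_sub_cancel_left, add_comm 1 j]
    simp
  · rw [mul_sum]
    refine sum_congr rfl fun m hm => ?_
    have h := congrArg (Nat.cast (R := ℚ[X]))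
      (mul_choose_two_mul_mul_catalan hr (Nat.lt_succ_iff.mp (mem_range.mp hm)))
    push_cast at h
    rw [← h]
    simp only [C_mul, C_eq_natCast]
    ring
end

section
/- For all integers 0 ≤ m ≤ n, Σ_{i=m}^{n} (-1)^{n-i} · binom(n+i,2i) · binom(i+1,m+1) · Cat_i = binom(m+n,2m) · Cat_m, where Cat_i is the i-th Catalan number. -/
open Finset

theorem sum_neg_one_pow_mul_choose_mul_choose_add (k p x : ℕ) :
    ∑ j ∈ range (k + 1), (-1 : ℤ) ^ (k - j) * k.choose j * (x + j).choose (k + p) =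
      x.choose p := by
  have h := congrFun (fwdDiff_iter_choose p k) x
  rw [fwdDiff_iter_eq_sum_shift] at h
  simpa using h

theorem choose_mul_choose_mul_catalan_mul_factorial {m n i : ℕ} (hmi : m ≤ i) (hin : i ≤ n) :
    (n + i).choose (2 * i) * (i + 1).choose (m + 1) * catalan i *
      ((m + 1).factorial * (n - m).factorial) =
      (n - m).choose (i - m) * (n + i).choose n * n.factorial := by
  obtain ⟨c, hc⟩ : ∃ c : ℚ, catalan i = c := ⟨_, rfl⟩
  have hcat : c = (2 * i).factorial / (i.factorial * (i + 1).factorial) := by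
    have h := succ_mul_catalan_eq_centralBinom i
    rw [Nat.centralBinom_eq_two_mul_choose, two_mul] at h
    have h' : ((i : ℚ) + 1) * c = ((i + i).choose i : ℕ) := by rw [← hc]; exact_mod_cast h
    rw [Nat.cast_add_choose, ← two_mul] at h'
    have hi : (i.factorial : ℚ) ≠ 0 := by positivity
    have hi' : (i : ℚ) + 1 ≠ 0 := by positivity
    rw [Nat.factorial_succ]
    push_cast
    field_simp at h' ⊢
    linarith
  suffices h : ((n + i).choose (2 * i) * (i + 1).choose (m + 1) * catalan i *
      ((m + 1).factorial * (n - m).factorial) : ℚ) =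
      (n - m).choose (i - m) * (n + i).choose n * n.factorial by exact_mod_cast h
  rw [hc, hcat, Nat.cast_choose ℚ (by omega : 2 * i ≤ n + i),
    Nat.cast_choose ℚ (by omega : m + 1 ≤ i + 1), Nat.cast_choose ℚ (by omega : i - m ≤ n - m),
    Nat.cast_add_choose, show n + i - 2 * i = n - i by omega,
    show i + 1 - (m + 1) = i - m by omega, show n - m - (i - m) = n - i by omega]
  field_simp

theorem catalan_identity (m n : ℕ) (hmn : m ≤ n) :
    ∑ i ∈ Finset.Icc m n,
      (-1 : ℤ) ^ (n - i) * ((n + i).choose (2 * i)) * ((i + 1).choose (m + 1)) * catalan i =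
      ((m + n).choose (2 * m)) * catalan m := by
  have hK : (((m + 1).factorial * (n - m).factorial : ℕ) : ℤ) ≠ 0 := by positivity
  refine mul_right_cancel₀ hK ?_
  have hm := choose_mul_choose_mul_catalan_mul_factorial le_rfl hmn
  rw [Nat.choose_self, Nat.sub_self, Nat.choose_zero_right, mul_one, one_mul, Nat.choose_symm_add,
    add_comm n m] at hm
  rw [← Nat.cast_mul, ← Nat.cast_mul, hm, sum_mul, ← Ico_add_one_right_eq_Icc,
    sum_Ico_eq_sum_range, show n + 1 - m = n - m + 1 by omega, Nat.cast_mul _ n.factorial, add_comm m n,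
    ← sum_neg_one_pow_mul_choose_mul_choose_add (n - m) m (n + m), sum_mul]
  refine sum_congr rfl fun j hj => ?_
  have hj' : m + j ≤ n := by have := mem_range.mp hj; omega
  have h := choose_mul_choose_mul_catalan_mul_factorial (Nat.le_add_right m j) hj'
  rw [Nat.add_sub_cancel_left, ← add_assoc] at h
  rw [Nat.sub_add_cancel hmn, Nat.sub_sub, ← add_assoc n m j]
  zify at h
  push_cast
  linear_combination (-1 : ℤ) ^ (n - (m + j)) * h
end

section
/- For every integer r ≥ 1, q·C_r(q) = Σ_{μ ⊢ r} z_μ^{-1} · (r+1)^{ℓ(μ)-1} · Π_{i≥1} (1-(1-q)^i)^{m_i(μ)}, as an identity of polynomials in q with rational coefficients, where the sum is over all integer partitions μ of r. -/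
open Polynomial Finset

/-- `z_μ = ∏_i i^{m_i(μ)} · m_i(μ)!` for a partition `μ`, as a rational number. -/
def zPartition {n : ℕ} (μ : n.Partition) : ℚ :=
  ∏ i ∈ μ.parts.toFinset, ((i : ℚ) ^ (μ.parts.count i) * (Nat.factorial (μ.parts.count i)))

/-- The monomial `∏_i y_i ^ m_i / (i ^ m_i * m_i!)` attached to a multiset `s` in which each `i`
has multiplicity `m_i`. -/
noncomputable def cycleWeight {R : Type*} [CommRing R] [Algebra ℚ R] (y : ℕ → R)
    (s : Multiset ℕ) : R :=
  ∏ i ∈ s.toFinset,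
    (algebraMap ℚ R ((i : ℚ) ^ s.count i * (s.count i).factorial)⁻¹ * y i ^ s.count i)

section CycleWeight

variable {R : Type*} [CommRing R] [Algebra ℚ R]

theorem cycleWeight_cons (y : ℕ → R) (s : Multiset ℕ) {i : ℕ} (hi : i ≠ 0) :
    ((i ::ₘ s).count i * i : R) * cycleWeight y (i ::ₘ s) = y i * cycleWeight y s := by
  have hs : cycleWeight y s = ∏ j ∈ insert i s.toFinset,
      (algebraMap ℚ R ((j : ℚ) ^ s.count j * (s.count j).factorial)⁻¹ * y j ^ s.count j) := by
    refine Finset.prod_subset (Finset.subset_insert _ _) fun j _ hj => ?_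
    have h : s.count j = 0 := by simpa using hj
    simp [h]
  rw [hs, cycleWeight, Multiset.toFinset_cons,
    ← Finset.mul_prod_erase _ _ (Finset.mem_insert_self i s.toFinset),
    ← Finset.mul_prod_erase _ _ (Finset.mem_insert_self i s.toFinset)]
  have hrest : ∀ j ∈ (insert i s.toFinset).erase i, (i ::ₘ s).count j = s.count j :=
    fun j hj => Multiset.count_cons_of_ne (Finset.ne_of_mem_erase hj) s
  rw [Finset.prod_congr rfl fun j hj => by rw [hrest j hj], Multiset.count_cons_self]
  have hcoef : ((s.count i + 1 : ℕ) * i : R) *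
      algebraMap ℚ R ((i : ℚ) ^ (s.count i + 1) * (s.count i + 1).factorial)⁻¹ =
      algebraMap ℚ R ((i : ℚ) ^ s.count i * (s.count i).factorial)⁻¹ := by
    rw [← map_natCast (algebraMap ℚ R) (s.count i + 1), ← map_natCast (algebraMap ℚ R) i,
      ← map_mul, ← map_mul]
    congr 1
    have : (i : ℚ) ≠ 0 := by exact_mod_cast hi
    have : ((s.count i).factorial : ℚ) ≠ 0 := by positivity
    rw [Nat.factorial_succ]
    push_cast
    field_simp
    rw [pow_succ']
  rw [← hcoef]
  ring

/-- Newton's recursion for the sum of `cycleWeight` over the partitions of `n`. -/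
theorem natCast_mul_sum_cycleWeight (y : ℕ → R) (n : ℕ) :
    (n : R) * ∑ μ : n.Partition, cycleWeight y μ.parts =
      ∑ i ∈ Finset.Icc 1 n, y i * ∑ μ : (n - i).Partition, cycleWeight y μ.parts := by
  have h1 : ∀ μ : n.Partition, (n : R) * cycleWeight y μ.parts =
      ∑ i ∈ μ.parts.toFinset, (μ.parts.count i * i : R) * cycleWeight y μ.parts := by
    intro μ
    rw [← Finset.sum_mul]
    congr 1
    conv_lhs => rw [← μ.parts_sum, Finset.sum_multiset_count]
    simp
  rw [Finset.mul_sum, Finset.sum_congr rfl fun μ _ => h1 μ]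
  simp_rw [Finset.mul_sum]
  rw [Finset.sum_sigma', Finset.sum_sigma']
  symm
  refine Finset.sum_bij
    (fun a ha => ⟨⟨a.1 ::ₘ a.2.parts, ?_, ?_⟩, a.1⟩) ?_ ?_ ?_ ?_
  · intro j hj
    have := (Finset.mem_Icc.1 (Finset.mem_sigma.1 ha).1).1
    rcases Multiset.mem_cons.1 hj with rfl | hj
    · exact this
    · exact a.2.parts_pos hj
  · have := (Finset.mem_Icc.1 (Finset.mem_sigma.1 ha).1).2
    rw [Multiset.sum_cons, a.2.parts_sum]
    omega
  · intro a ha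
    simp
  · rintro ⟨i, μ⟩ _ ⟨j, ν⟩ _ h
    simp only [Sigma.mk.injEq, heq_eq_eq, Nat.Partition.mk.injEq] at h
    obtain ⟨h, rfl⟩ := h
    rw [Multiset.cons_inj_right] at h
    rw [Nat.Partition.ext h]
  · rintro ⟨μ, i⟩ h
    have hi : i ∈ μ.parts := by simpa using h
    have hc := Multiset.cons_erase hi
    have hsum : i + (μ.parts.erase i).sum = n := by
      rw [← Multiset.sum_cons, hc, μ.parts_sum]
    refine ⟨⟨i, ⟨μ.parts.erase i, fun hj => μ.parts_pos (Multiset.mem_of_mem_erase hj),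
      by omega⟩⟩, ?_, ?_⟩
    · have := μ.parts_pos hi
      simp only [Finset.mem_sigma, Finset.mem_Icc, Finset.mem_univ, and_true]
      omega
    · simp only [Sigma.mk.injEq, heq_eq_eq, and_true]
      exact Nat.Partition.ext hc
  · intro a ha
    have := (Finset.mem_Icc.1 (Finset.mem_sigma.1 ha).1).1
    exact (cycleWeight_cons y a.2.parts (by omega)).symm

/-- If `X * G' = G * ∑_{i ≥ 1} y_i X^i` and `G` has constant coefficient `1`, then `G` is the
generating function of the sums of `cycleWeight` over partitions. -/
theorem coeff_eq_sum_cycleWeight (y : ℕ → R) (hy : y 0 = 0) (G : PowerSeries R)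
    (h0 : PowerSeries.coeff 0 G = 1)
    (hG : PowerSeries.X * PowerSeries.derivative R G = PowerSeries.mk y * G) (n : ℕ) :
    PowerSeries.coeff n G = ∑ μ : n.Partition, cycleWeight y μ.parts := by
  induction n using Nat.strong_induction_on with
  | _ n ih =>
    rcases Nat.eq_zero_or_pos n with rfl | hn
    · rw [h0, Fintype.sum_unique]
      simp [cycleWeight]
    · have hrec : (n : R) * PowerSeries.coeff n G =
          (n : R) * ∑ μ : n.Partition, cycleWeight y μ.parts := by
        rw [natCast_mul_sum_cycleWeight]
        have h := congrArg (PowerSeries.coeff n) hG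
        obtain ⟨m, rfl⟩ : ∃ m, n = m + 1 := ⟨n - 1, by omega⟩
        rw [PowerSeries.coeff_succ_X_mul, PowerSeries.coeff_derivative,
          PowerSeries.coeff_mul, Finset.Nat.sum_antidiagonal_eq_sum_range_succ_mk,
          Finset.sum_range_succ'] at h
        simp only [PowerSeries.coeff_mk, hy, zero_mul, add_zero] at h
        rw [mul_comm]
        push_cast
        rw [h, Finset.range_eq_Ico, Finset.sum_Ico_add' (fun i => y i *
          PowerSeries.coeff (m + 1 - i) G) 0 (m + 1) 1]
        refine Finset.sum_congr (by ext; simp) fun i hi => ?_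
        rw [Finset.mem_Icc] at hi
        rw [ih (m + 1 - i) (by omega)]
      have hinv : algebraMap ℚ R (n : ℚ)⁻¹ * (n : R) = 1 := by
        rw [← map_natCast (algebraMap ℚ R) n, ← map_mul, inv_mul_cancel₀ (by positivity), map_one]
      calc _ = algebraMap ℚ R (n : ℚ)⁻¹ * ((n : R) * PowerSeries.coeff n G) := by
            rw [← mul_assoc, hinv, one_mul]
        _ = _ := by rw [hrec, ← mul_assoc, hinv, one_mul]

end CycleWeight

section PowerSeriesIdentities

variable {R : Type*} [CommRing R]

theorem X_mul_derivative_one_add_C_mul_X_mul_mk_one (q : R) :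
    PowerSeries.X * PowerSeries.derivative R
        (1 + PowerSeries.C q * (PowerSeries.X * PowerSeries.mk 1)) =
      PowerSeries.mk (fun i => 1 - (1 - q) ^ i) *
        (1 + PowerSeries.C q * (PowerSeries.X * PowerSeries.mk 1)) := by
  set B : PowerSeries R := PowerSeries.mk 1 with hB
  set D : PowerSeries R := PowerSeries.mk (fun i => (1 - q) ^ i) with hD
  have hB1 : B * (1 - PowerSeries.X) = 1 := PowerSeries.mk_one_mul_one_sub_eq_one R
  have hD1 : D * (1 - PowerSeries.C (1 - q) * PowerSeries.X) = 1 := by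
    ext n
    rcases n with _ | n
    · simp [hD, mul_sub]
    · rw [mul_sub, mul_one, mul_left_comm, map_sub, PowerSeries.coeff_C_mul,
        PowerSeries.coeff_succ_mul_X]
      simp [hD, PowerSeries.coeff_one, pow_succ']
  have hS : PowerSeries.mk (fun i => 1 - (1 - q) ^ i) = B - D := by
    ext n
    simp [hB, hD]
  have hdB : PowerSeries.derivative R B = B * B := by
    have h := congrArg (PowerSeries.derivative R) hB1
    simp only [Derivation.leibniz, map_sub, Derivation.map_one_eq_zero, smul_eq_mul,
      PowerSeries.derivative_X] at h
    linear_combination B * h - (PowerSeries.derivative R B) * hB1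
  rw [hS]
  simp only [map_add, Derivation.leibniz, Derivation.map_one_eq_zero, smul_eq_mul,
    PowerSeries.derivative_X, PowerSeries.derivative_C, hdB]
  rw [map_sub, map_one] at hD1
  linear_combination B * hD1 - (PowerSeries.C q * PowerSeries.X * B + D) * hB1

theorem coeff_one_add_C_mul_X_mul_mk_one_pow (q : R) (N : ℕ) {r : ℕ} (hr : 1 ≤ r) :
    PowerSeries.coeff r ((1 + PowerSeries.C q * (PowerSeries.X * PowerSeries.mk 1)) ^ N) =
      ∑ k ∈ Finset.range N, (if k < r then
        ((N.choose (k + 1) * (r - 1).choose k : ℕ) : R) * q ^ (k + 1) else 0) := by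
  rw [add_comm, add_pow, map_sum, Finset.sum_range_succ']
  have h0 : r ≠ 0 := by omega
  simp only [one_pow, mul_one, pow_zero, Nat.choose_zero_right, Nat.cast_one,
    PowerSeries.coeff_one, h0, if_false, add_zero]
  refine Finset.sum_congr rfl fun k _ => ?_
  rw [mul_pow, mul_pow, PowerSeries.mk_one_pow_eq_mk_choose_add, ← map_pow,
    ← map_natCast (PowerSeries.C (R := R)), mul_comm, PowerSeries.coeff_C_mul,
    PowerSeries.coeff_C_mul, PowerSeries.coeff_X_pow_mul']
  by_cases hk : k < r
  · rw [if_pos hk, if_pos (by omega), PowerSeries.coeff_mk,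
      show k + (r - (k + 1)) = r - 1 by omega]
    push_cast
    ring
  · rw [if_neg hk, if_neg (by omega)]
    simp

end PowerSeriesIdentities

theorem X_mul_narayana {r : ℕ} (hr : 1 ≤ r) :
    Polynomial.C ((r : ℚ) + 1) * (Polynomial.X * narayana r) =
      PowerSeries.coeff r
        ((1 + PowerSeries.C (Polynomial.X : Polynomial ℚ) *
          (PowerSeries.X * PowerSeries.mk 1)) ^ (r + 1)) := by
  rw [coeff_one_add_C_mul_X_mul_mk_one_pow _ _ hr, Finset.sum_range_succ, if_neg (lt_irrefl r),
    add_zero, narayana, if_neg (by omega), Finset.mul_sum, Finset.mul_sum]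
  have hIcc : Finset.Icc 1 r = Finset.Ico (0 + 1) (r + 1) := by ext; simp
  rw [hIcc, ← Finset.sum_Ico_add' _ 0 r 1, ← Finset.range_eq_Ico]
  refine Finset.sum_congr rfl fun k hk => ?_
  rw [if_pos (Finset.mem_range.1 hk), Nat.add_sub_cancel]
  obtain ⟨s, rfl⟩ : ∃ s, r = s + 1 := ⟨r - 1, by omega⟩
  have h1 : ((s + 1 + 1 : ℕ) : ℚ) * (s + 1).choose k =
      (s + 1 + 1).choose (k + 1) * (k + 1 : ℕ) := by
    exact_mod_cast Nat.add_one_mul_choose_eq (s + 1) k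
  have h2 : ((s + 1 : ℕ) : ℚ) * s.choose k = (s + 1).choose (k + 1) * (k + 1 : ℕ) := by
    exact_mod_cast Nat.add_one_mul_choose_eq s k
  have hcoef : ((s + 1 : ℕ) + 1 : ℚ) *
      (((s + 1).choose k * (s + 1).choose (k + 1) : ℚ) / (s + 1 : ℕ)) =
      ((s + 1 + 1).choose (k + 1) * s.choose k : ℕ) := by
    have hs : ((s + 1 : ℕ) : ℚ) ≠ 0 := by positivity
    have hk : ((k + 1 : ℕ) : ℚ) ≠ 0 := by positivity
    rw [← mul_div_assoc, div_eq_iff hs]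
    apply mul_right_cancel₀ hk
    push_cast at h1 h2 ⊢
    linear_combination ((s + 1).choose (k + 1) : ℚ) * (k + 1) * h1 -
      ((s + 1 + 1).choose (k + 1) : ℚ) * (k + 1) * h2
  rw [Nat.add_sub_cancel, ← map_natCast (Polynomial.C (R := ℚ)), ← hcoef, map_mul]
  ring

theorem narayana_partition_expansion (r : ℕ) (hr : 1 ≤ r) :
    Polynomial.X * narayana r =
      ∑ μ : r.Partition,
        Polynomial.C ((zPartition μ)⁻¹ * ((r : ℚ) + 1) ^ (Multiset.card μ.parts - 1)) *
          ∏ i ∈ μ.parts.toFinset,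
            (1 - (1 - Polynomial.X) ^ i) ^ (μ.parts.count i) := by
  have hr1 : Polynomial.C ((r : ℚ) + 1) ≠ 0 := by
    rw [Polynomial.C_ne_zero]
    positivity
  apply mul_left_cancel₀ hr1
  rw [X_mul_narayana hr, coeff_eq_sum_cycleWeight
    (fun i => Polynomial.C ((r : ℚ) + 1) * (1 - (1 - Polynomial.X) ^ i)) (by simp),
    Finset.mul_sum]
  · refine Finset.sum_congr rfl fun μ _ => ?_
    have hcard : Multiset.card μ.parts ≠ 0 := by
      intro h
      have := μ.parts_sum
      rw [Multiset.card_eq_zero.1 h, Multiset.sum_zero] at this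
      omega
    rw [cycleWeight, Finset.prod_mul_distrib, ← mul_assoc, ← map_mul, mul_left_comm,
      mul_pow_sub_one hcard, map_mul, zPartition, ← Finset.prod_inv_distrib, map_prod, mul_assoc]
    congr 1
    simp only [mul_pow]
    rw [Finset.prod_mul_distrib, Finset.prod_pow_eq_pow_sum, Multiset.toFinset_sum_count_eq,
      map_pow]
  · simp
  · rw [PowerSeries.derivative_pow]
    have h := X_mul_derivative_one_add_C_mul_X_mul_mk_one (Polynomial.X : Polynomial ℚ)
    have hmk : PowerSeries.mk (fun i => Polynomial.C ((r : ℚ) + 1) *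
        (1 - (1 - Polynomial.X : Polynomial ℚ) ^ i)) =
        ((r + 1 : ℕ) : PowerSeries (Polynomial ℚ)) *
          PowerSeries.mk (fun i => 1 - (1 - Polynomial.X) ^ i) := by
      ext1 n
      rw [← map_natCast (PowerSeries.C (R := Polynomial ℚ)), PowerSeries.coeff_C_mul]
      simp
    rw [hmk, Nat.add_sub_cancel, pow_succ]
    linear_combination ((r + 1 : ℕ) : PowerSeries (Polynomial ℚ)) *
      (1 + PowerSeries.C (Polynomial.X : Polynomial ℚ) *
          (PowerSeries.X * PowerSeries.mk 1)) ^ r * h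
end

section
/- For every integer r ≥ 1, the small Schröder number s_r satisfies s_r = Σ_{μ ⊢ r, all parts of μ odd} z_μ^{-1} · (2r+2)^{ℓ(μ)-1}, the sum being over all integer partitions μ of r having all parts odd. -/
open Polynomial Finset

/-- The small Schröder number `s_r = C_r(2)`. -/
noncomputable def smallSchroeder (r : ℕ) : ℚ := (narayana r).eval 2

/-- The generating polynomial `∑_μ z_μ⁻¹ t^{ℓ(μ)}` over the partitions of `n` into odd parts. -/
def oddPartitionSum (n : ℕ) (t : ℚ) : ℚ :=
  ∑ μ ∈ Finset.univ.filter (fun μ : n.Partition => ∀ i ∈ μ.parts, Odd i),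
    (zPartition μ)⁻¹ * t ^ Multiset.card μ.parts

lemma zPartition_eq_prod_of_subset {n : ℕ} (μ : n.Partition) {S : Finset ℕ}
    (hS : μ.parts.toFinset ⊆ S) :
    zPartition μ =
      ∏ i ∈ S, ((i : ℚ) ^ (μ.parts.count i) * (Nat.factorial (μ.parts.count i))) := by
  refine Finset.prod_subset hS fun i _ hi => ?_
  rw [Multiset.mem_toFinset] at hi
  simp [Multiset.count_eq_zero_of_notMem hi]

lemma zPartition_of_parts_eq_cons {m n i : ℕ} {μ : n.Partition} {ν : m.Partition}
    (h : μ.parts = i ::ₘ ν.parts) :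
    zPartition μ = (i * μ.parts.count i) * zPartition ν := by
  have hi : i ∈ insert i ν.parts.toFinset := Finset.mem_insert_self _ _
  rw [zPartition_eq_prod_of_subset μ (S := insert i ν.parts.toFinset) (by simp [h]),
    zPartition_eq_prod_of_subset ν (Finset.subset_insert i _),
    ← Finset.mul_prod_erase _ _ hi, ← Finset.mul_prod_erase _ _ hi, ← mul_assoc]
  congr 1
  · rw [h, Multiset.count_cons_self, pow_succ, Nat.factorial_succ]
    push_cast
    ring
  · refine Finset.prod_congr rfl fun j hj => ?_
    rw [h, Multiset.count_cons_of_ne (Finset.ne_of_mem_erase hj)]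

/-- Adjoin a positive part to a partition. -/
def Nat.Partition.consPart {a n : ℕ} (ν : a.Partition) (i : ℕ) (hi : 0 < i) (h : a + i = n) :
    n.Partition where
  parts := i ::ₘ ν.parts
  parts_pos := by
    intro j hj
    rcases Multiset.mem_cons.1 hj with rfl | hj
    · exact hi
    · exact ν.parts_pos hj
  parts_sum := by rw [Multiset.sum_cons, ν.parts_sum]; omega

/-- Remove a part from a partition. -/
def Nat.Partition.erasePart {a n : ℕ} (μ : n.Partition) (i : ℕ) (hi : i ∈ μ.parts)
    (h : a + i = n) : a.Partition where
  parts := μ.parts.erase i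
  parts_pos := fun hj => μ.parts_pos (Multiset.mem_of_mem_erase hj)
  parts_sum := by
    have := Multiset.sum_erase hi
    rw [μ.parts_sum] at this
    omega

lemma sum_count_mul_eq {a n i : ℕ} (hi : Odd i) (h : a + i = n) (t : ℚ) :
    ∑ μ ∈ Finset.univ.filter (fun μ : n.Partition => ∀ j ∈ μ.parts, Odd j),
      (i * μ.parts.count i : ℚ) * ((zPartition μ)⁻¹ * t ^ Multiset.card μ.parts) =
    t * oddPartitionSum a t := by
  rw [oddPartitionSum, Finset.mul_sum]
  have hsub : Finset.univ.filter
      (fun μ : n.Partition => (∀ j ∈ μ.parts, Odd j) ∧ i ∈ μ.parts) ⊆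
      Finset.univ.filter (fun μ : n.Partition => ∀ j ∈ μ.parts, Odd j) :=
    Finset.monotone_filter_right _ fun _ _ h => h.1
  rw [← Finset.sum_subset hsub]
  · refine Finset.sum_bij' (fun μ hμ => μ.erasePart i (Finset.mem_filter.1 hμ).2.2 h)
      (fun ν _ => ν.consPart i hi.pos h) ?_ ?_ ?_ ?_ ?_
    · intro μ hμ
      simp only [Finset.mem_filter, Finset.mem_univ, true_and] at hμ ⊢
      exact fun j hj => hμ.1 j (Multiset.mem_of_mem_erase hj)
    · intro ν hν
      simp only [Finset.mem_filter, Finset.mem_univ, true_and] at hν ⊢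
      refine ⟨fun j hj => ?_, Multiset.mem_cons_self _ _⟩
      rcases Multiset.mem_cons.1 hj with rfl | hj
      · exact hi
      · exact hν j hj
    · intro μ hμ
      exact Nat.Partition.ext (Multiset.cons_erase (Finset.mem_filter.1 hμ).2.2)
    · intro ν _
      exact Nat.Partition.ext (Multiset.erase_cons_head _ _)
    · intro μ hμ
      have hmem := (Finset.mem_filter.1 hμ).2.2
      have hparts : μ.parts = i ::ₘ (μ.erasePart i hmem h).parts :=
        (Multiset.cons_erase hmem).symm
      have hc : (μ.parts.count i : ℚ) ≠ 0 :=
        Nat.cast_ne_zero.2 (Multiset.count_ne_zero.2 hmem)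
      have hi0 : (i : ℚ) ≠ 0 := Nat.cast_ne_zero.2 hi.pos.ne'
      have hcard : Multiset.card μ.parts =
          Multiset.card (μ.erasePart i hmem h).parts + 1 := by
        conv_lhs => rw [hparts, Multiset.card_cons]
      rw [zPartition_of_parts_eq_cons hparts, hcard, mul_inv, pow_succ, mul_assoc _⁻¹,
        mul_inv_cancel_left₀ (mul_ne_zero hi0 hc)]
      ring
  · intro μ hμ hμ'
    have : i ∉ μ.parts := fun hmem =>
      hμ' (Finset.mem_filter.2 ⟨Finset.mem_univ _, (Finset.mem_filter.1 hμ).2, hmem⟩)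
    simp [Multiset.count_eq_zero_of_notMem this]

lemma Nat.Partition.sum_antidiagonal_count {n : ℕ} (μ : (n + 1).Partition) :
    ∑ p ∈ Finset.HasAntidiagonal.antidiagonal n, (p.2 + 1) * μ.parts.count (p.2 + 1) = n + 1 := by
  have hsub : μ.parts.toFinset ⊆ Finset.range (n + 1 + 1) := fun i hi =>
    Finset.mem_range.2
      (Nat.lt_succ_of_le (Nat.Partition.le_of_mem_parts (Multiset.mem_toFinset.1 hi)))
  have h := Finset.sum_multiset_count_of_subset μ.parts _ hsub
  rw [μ.parts_sum, Finset.sum_range_succ'] at h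
  rw [Finset.Nat.antidiagonal_eq_map', Finset.sum_map]
  simp only [smul_eq_mul, mul_zero, add_zero] at h
  refine Eq.trans (Finset.sum_congr rfl fun i _ => ?_) h.symm
  exact mul_comm _ _

lemma oddPartitionSum_succ (n : ℕ) (t : ℚ) :
    (n + 1) * oddPartitionSum (n + 1) t =
      t * ∑ p ∈ Finset.HasAntidiagonal.antidiagonal n, oddPartitionSum p.1 t * if Even p.2 then 1 else 0 := by
  have key : ∀ p ∈ Finset.HasAntidiagonal.antidiagonal n,
      ∑ μ ∈ Finset.univ.filter (fun μ : (n + 1).Partition => ∀ j ∈ μ.parts, Odd j),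
        ((p.2 + 1 : ℕ) * μ.parts.count (p.2 + 1) : ℚ) *
          ((zPartition μ)⁻¹ * t ^ Multiset.card μ.parts) =
      t * (oddPartitionSum p.1 t * if Even p.2 then 1 else 0) := by
    intro p hp
    rw [Finset.HasAntidiagonal.mem_antidiagonal] at hp
    split_ifs with he
    · rw [mul_one]
      exact sum_count_mul_eq he.add_one (by omega) t
    · rw [mul_zero, mul_zero]
      refine Finset.sum_eq_zero fun μ hμ => ?_
      have hn : p.2 + 1 ∉ μ.parts := fun hmem =>
        he (by simpa [parity_simps] using (Finset.mem_filter.1 hμ).2 _ hmem)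
      simp [Multiset.count_eq_zero_of_notMem hn]
  rw [Finset.mul_sum, ← Finset.sum_congr rfl key, Finset.sum_comm, oddPartitionSum,
    Finset.mul_sum]
  refine Finset.sum_congr rfl fun μ _ => ?_
  rw [← Finset.sum_mul]
  congr 1
  exact_mod_cast μ.sum_antidiagonal_count.symm

lemma oddPartitionSum_zero (t : ℚ) : oddPartitionSum 0 t = 1 := by
  simp [oddPartitionSum, zPartition]

/-- The power series `(1 + X) / (1 - X)`. -/
noncomputable def cayleySeries : PowerSeries ℚ := (1 + PowerSeries.X) * PowerSeries.mk 1

lemma cayleySeries_eq_add_one : cayleySeries = 2 * PowerSeries.X * PowerSeries.mk 1 + 1 := by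
  have h := PowerSeries.mk_one_mul_one_sub_eq_one ℚ
  rw [cayleySeries]
  linear_combination h

lemma mk_even_mul_one_add_X :
    (PowerSeries.mk fun n => if Even n then (1 : ℚ) else 0) * (1 + PowerSeries.X) =
      PowerSeries.mk 1 := by
  ext n
  rw [mul_add, mul_one, map_add]
  cases n with
  | zero => simp
  | succ n => by_cases h : Even n <;> simp [PowerSeries.coeff_succ_mul_X, parity_simps, h]

lemma derivative_mk_one :
    PowerSeries.derivative ℚ (PowerSeries.mk 1 : PowerSeries ℚ) = PowerSeries.mk 1 ^ 2 := by
  ext n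
  rw [PowerSeries.coeff_derivative, PowerSeries.mk_one_pow_eq_mk_choose_add ℚ 1]
  simp [add_comm]

lemma derivative_cayleySeries_pow (m : ℕ) :
    PowerSeries.derivative ℚ (cayleySeries ^ m) =
      (2 * m) * (cayleySeries ^ m * PowerSeries.mk fun n => if Even n then (1 : ℚ) else 0) := by
  have h := PowerSeries.mk_one_mul_one_sub_eq_one ℚ
  have hd : PowerSeries.derivative ℚ cayleySeries =
      2 * (cayleySeries * PowerSeries.mk fun n => if Even n then (1 : ℚ) else 0) := by
    have hK := mk_even_mul_one_add_X
    rw [cayleySeries, Derivation.leibniz, derivative_mk_one]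
    simp only [map_add, PowerSeries.derivative_X, Derivation.map_one_eq_zero, smul_eq_mul]
    linear_combination -PowerSeries.mk 1 * h - 2 * PowerSeries.mk 1 * hK
  cases m with
  | zero => simp
  | succ m =>
    rw [PowerSeries.derivative_pow, hd, Nat.add_sub_cancel, pow_succ]
    ring

lemma oddPartitionSum_eq_coeff (n m : ℕ) :
    oddPartitionSum n (2 * m) = PowerSeries.coeff n (cayleySeries ^ m) := by
  induction n using Nat.strong_induction_on with
  | _ n ih =>
    cases n with
    | zero => simp [oddPartitionSum_zero, cayleySeries]
    | succ n =>
      have hn : (n + 1 : ℚ) ≠ 0 := by positivity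
      apply mul_left_cancel₀ hn
      have hd := congrArg (PowerSeries.coeff n) (derivative_cayleySeries_pow m)
      have h2m : (2 * m : PowerSeries ℚ) = PowerSeries.C (2 * m : ℚ) := by
        rw [map_mul, map_ofNat, map_natCast]
      rw [PowerSeries.coeff_derivative, h2m, PowerSeries.coeff_C_mul, PowerSeries.coeff_mul] at hd
      rw [oddPartitionSum_succ, mul_comm (n + 1 : ℚ), hd]
      congr 1
      refine Finset.sum_congr rfl fun p hp => ?_
      rw [Finset.HasAntidiagonal.mem_antidiagonal] at hp
      rw [ih p.1 (by omega), PowerSeries.coeff_mk]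

lemma choose_mul_choose_div (r k : ℕ) :
    (((r + 1).choose k * (r + 1).choose (k + 1) : ℚ)) / (r + 1 : ℕ) =
      ((r + 2).choose (k + 1) * r.choose k : ℚ) / (r + 2) := by
  have h1 : ((r + 2 : ℚ)) * (r + 1).choose k = (r + 2).choose (k + 1) * (k + 1) := by
    exact_mod_cast Nat.add_one_mul_choose_eq (r + 1) k
  have h2 : ((r + 1 : ℚ)) * r.choose k = (r + 1).choose (k + 1) * (k + 1) := by
    exact_mod_cast Nat.add_one_mul_choose_eq r k
  have hk : (k + 1 : ℚ) ≠ 0 := by positivity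
  push_cast
  rw [div_eq_div_iff (by positivity) (by positivity)]
  apply mul_left_cancel₀ hk
  linear_combination (r + 1).choose (k + 1) * (k + 1 : ℚ) * h1 -
    (r + 2).choose (k + 1) * (k + 1 : ℚ) * h2

lemma coeff_cayleySeries_pow (r m : ℕ) :
    PowerSeries.coeff (r + 1) (cayleySeries ^ (m + 1)) =
      ∑ k ∈ Finset.range (m + 1), 2 ^ (k + 1) * ((m + 1).choose (k + 1) * r.choose k : ℚ) := by
  rw [cayleySeries_eq_add_one, add_pow, map_sum, Finset.sum_range_succ']
  simp only [pow_zero, one_pow, mul_one, Nat.choose_zero_right, Nat.cast_one,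
    PowerSeries.coeff_one, Nat.add_eq_zero_iff, one_ne_zero, and_false, if_false, add_zero]
  refine Finset.sum_congr rfl fun k _ => ?_
  have : (2 * PowerSeries.X * PowerSeries.mk 1 : PowerSeries ℚ) ^ (k + 1) *
      ((m + 1).choose (k + 1) : PowerSeries ℚ) =
      PowerSeries.C (2 ^ (k + 1) * (m + 1).choose (k + 1) : ℚ) *
        (PowerSeries.X ^ (k + 1) * PowerSeries.mk 1 ^ (k + 1)) := by
    simp only [map_mul, map_pow, map_natCast, map_ofNat]
    ring
  rw [this, PowerSeries.coeff_C_mul, PowerSeries.coeff_X_pow_mul',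
    PowerSeries.mk_one_pow_eq_mk_choose_add, PowerSeries.coeff_mk]
  split_ifs with hk
  · rw [show k + (r + 1 - (k + 1)) = r by omega]
    ring
  · rw [Nat.choose_eq_zero_of_lt (show r < k by omega)]
    simp

lemma smallSchroeder_eq_coeff (r : ℕ) :
    smallSchroeder (r + 1) =
      PowerSeries.coeff (r + 1) (cayleySeries ^ (r + 2)) / (2 * (r + 2)) := by
  have hI : Finset.Icc 1 (r + 1) = (Finset.range (r + 1)).map (addRightEmbedding 1) := by
    ext k
    simp only [Finset.mem_Icc, Finset.mem_map, Finset.mem_range, addRightEmbedding_apply]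
    exact ⟨fun h => ⟨k - 1, by omega, by omega⟩, by rintro ⟨j, hj, rfl⟩; omega⟩
  rw [coeff_cayleySeries_pow, Finset.sum_range_succ,
    Nat.choose_eq_zero_of_lt (show r < r + 1 by omega), Nat.cast_zero, mul_zero, mul_zero,
    add_zero, Finset.sum_div, smallSchroeder, narayana, if_neg r.succ_ne_zero, hI,
    Finset.sum_map, eval_finsetSum]
  refine Finset.sum_congr rfl fun k _ => ?_
  simp only [addRightEmbedding_apply, Nat.add_sub_cancel, eval_mul, eval_C, eval_pow, eval_X]
  rw [choose_mul_choose_div]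
  field_simp
  ring

theorem smallSchroeder_partition_expansion (r : ℕ) (hr : 1 ≤ r) :
    smallSchroeder r =
      ∑ μ ∈ Finset.univ.filter (fun μ : r.Partition => ∀ i ∈ μ.parts, Odd i),
        (zPartition μ)⁻¹ * ((2 * r : ℚ) + 2) ^ (Multiset.card μ.parts - 1) := by
  obtain ⟨r, rfl⟩ := Nat.exists_eq_add_of_le' hr
  have h0 : (2 * (r + 2 : ℕ) : ℚ) ≠ 0 := by positivity
  have ht : (2 * (r + 1 : ℕ) : ℚ) + 2 = 2 * (r + 2 : ℕ) := by push_cast; ring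
  rw [smallSchroeder_eq_coeff, ← oddPartitionSum_eq_coeff, oddPartitionSum, Finset.sum_div, ht]
  refine Finset.sum_congr rfl fun μ _ => ?_
  have hc : Multiset.card μ.parts ≠ 0 := by
    intro h
    have hs := μ.parts_sum
    simp [Multiset.card_eq_zero.1 h] at hs
  obtain ⟨c, hc⟩ := Nat.exists_eq_succ_of_ne_zero hc
  rw [hc, Nat.succ_sub_one, Nat.succ_eq_add_one, pow_succ]
  push_cast at h0 ⊢
  field_simp
end

section
/- Let E = {x_1,…,x_n} be n elements of a commutative ring (n ≥ 1) and let y_1,…,y_n be further elements. For a subset A ⊆ {1,…,n} write |A| = Σ_{a∈A} x_a. Then Σ_{A ⊆ {1,…,n}} (-1)^{n-|A|_card} · Π_{i=1}^{n} (|A| + y_i) = n! · Π_{i=1}^{n} x_i, where |A|_card denotes the cardinality of A. -/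
open Finset

open Polynomial in
/-- The finite difference of a polynomial of degree at most `k + 1` has degree at most `k`. -/
theorem natDegree_taylor_sub_self_le {R : Type*} [CommRing R] {p : R[X]} {k : ℕ}
    (hp : p.natDegree ≤ k + 1) (r : R) : (taylor r p - p).natDegree ≤ k := by
  rw [natDegree_le_iff_coeff_eq_zero]
  intro m hm
  have hdeg : (hasseDeriv m p).natDegree ≤ 0 :=
    (natDegree_hasseDeriv_le p m).trans (by omega)
  rw [coeff_sub, taylor_coeff, eq_C_of_natDegree_le_zero hdeg, eval_C, hasseDeriv_coeff]
  simp

open Polynomial in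
/-- The leading coefficient of the finite difference of a polynomial of degree at most `k + 1`. -/
theorem coeff_taylor_sub_self {R : Type*} [CommRing R] {p : R[X]} {k : ℕ}
    (hp : p.natDegree ≤ k + 1) (r : R) :
    (taylor r p - p).coeff k = (k + 1) * p.coeff (k + 1) * r := by
  have hdeg : (hasseDeriv k p).natDegree ≤ 1 :=
    (natDegree_hasseDeriv_le p k).trans (by omega)
  rw [coeff_sub, taylor_coeff, eq_X_add_C_of_natDegree_le_one hdeg]
  simp only [eval_add, eval_mul, eval_C, eval_X, hasseDeriv_coeff, zero_add, Nat.choose_self,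
    Nat.cast_one, one_mul, add_comm 1 k, Nat.choose_succ_self_right, Nat.cast_add]
  ring

open Polynomial in
/-- The iterated finite difference at `0` of a polynomial of degree at most `#s`, with the steps
`x i` for `i ∈ s`, only depends on the coefficient of degree `#s`. -/
theorem sum_powerset_neg_one_pow_mul_eval {R ι : Type*} [CommRing R] (x : ι → R)
    (s : Finset ι) (p : R[X]) (hp : p.natDegree ≤ #s) :
    ∑ A ∈ s.powerset, (-1 : R) ^ (#s - #A) * p.eval (∑ a ∈ A, x a) =
      ((#s).factorial : R) * p.coeff #s * ∏ i ∈ s, x i := by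
  classical
  induction s using Finset.induction_on generalizing p with
  | empty => simp [coeff_zero_eq_eval_zero]
  | insert b s hb ih =>
    rw [card_insert_of_notMem hb] at hp ⊢
    have key := ih (taylor (x b) p - p) (natDegree_taylor_sub_self_le hp _)
    rw [coeff_taylor_sub_self hp] at key
    rw [sum_powerset_insert hb, ← sum_add_distrib, prod_insert hb, Nat.factorial_succ]
    push_cast
    trans ∑ A ∈ s.powerset, (-1 : R) ^ (#s - #A) * (taylor (x b) p - p).eval (∑ a ∈ A, x a)
    · refine sum_congr rfl fun A hA => ?_
      have hAs := mem_powerset.1 hA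
      have hbA : b ∉ A := fun h => hb (hAs h)
      rw [card_insert_of_notMem hbA, sum_insert hbA, Nat.succ_sub (card_le_card hAs),
        Nat.add_sub_add_right, eval_sub, taylor_eval, add_comm (x b), pow_succ]
      ring
    · rw [key]
      ring

theorem subset_sum_identity (R : Type*) [CommRing R] (n : ℕ) (hn : 1 ≤ n)
    (x y : Fin n → R) :
    ∑ A : Finset (Fin n),
      (-1 : R) ^ (n - A.card) * ∏ i : Fin n, ((∑ a ∈ A, x a) + y i) =
      (n.factorial : R) * ∏ i : Fin n, x i := by
  nontriviality R
  have hmonic : (∏ i, (Polynomial.X + Polynomial.C (y i))).Monic :=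
    Polynomial.monic_prod_of_monic _ _ fun i _ => Polynomial.monic_X_add_C (y i)
  have hdeg : (∏ i, (Polynomial.X + Polynomial.C (y i))).natDegree = n := by
    rw [Polynomial.natDegree_prod_of_monic _ _ fun i _ => Polynomial.monic_X_add_C (y i)]
    simp
  have hcoeff := hmonic.coeff_natDegree
  rw [hdeg] at hcoeff
  have h := sum_powerset_neg_one_pow_mul_eval x univ
    (∏ i, (Polynomial.X + Polynomial.C (y i))) (by simp [hdeg])
  simpa [hcoeff, Polynomial.eval_prod] using h
end

section
/- Let E = {x_1,…,x_n} be n elements of a commutative ring (n ≥ 1) and let y_1,…,y_{n-1} be further elements. For a subset A ⊆ {1,…,n} write |A| = Σ_{a∈A} x_a. Then Σ_{A ⊆ {1,…,n}} (-1)^{n-|A|_card} · Π_{i=1}^{n-1} (|A| + y_i) = 0, where |A|_card denotes the cardinality of A. -/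
open Finset

/-- Subtracting a translate of a polynomial lowers its degree. -/
theorem Polynomial.degree_sub_taylor_lt {R : Type*} [CommRing R] (r : R) {p : Polynomial R}
    (hp : p ≠ 0) : (p - Polynomial.taylor r p).degree < p.degree :=
  Polynomial.degree_sub_lt_left (Polynomial.degree_taylor p r).symm hp
    (Polynomial.leadingCoeff_taylor r p).symm

/-- The alternating sum of the values of a polynomial over all subset sums of a finite family
vanishes when the degree of the polynomial is less than the size of the family. -/
theorem Polynomial.sum_powerset_neg_one_pow_card_mul_eval_sum {R ι : Type*} [CommRing R]
    (x : ι → R) (s : Finset ι) (p : Polynomial R) (hp : p.degree < s.card) :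
    ∑ A ∈ s.powerset, (-1 : R) ^ A.card * p.eval (∑ a ∈ A, x a) = 0 := by
  classical
  induction s using Finset.induction_on generalizing p with
  | empty =>
    have h : p = 0 := by simpa using hp
    simp [h]
  | insert a s ha ih =>
    by_cases h0 : p = 0
    · simp [h0]
    have hq : (p - Polynomial.taylor (x a) p).degree < s.card := by
      rw [card_insert_of_notMem ha, Polynomial.degree_eq_natDegree h0, Nat.cast_lt] at hp
      refine (Polynomial.degree_sub_taylor_lt (x a) h0).trans_le ?_
      rw [Polynomial.degree_eq_natDegree h0, Nat.cast_le]
      exact Nat.lt_succ_iff.mp hp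
    rw [sum_powerset_insert ha, ← sum_add_distrib, ← ih _ hq]
    refine sum_congr rfl fun A hA => ?_
    have haA : a ∉ A := fun h => ha (mem_powerset.mp hA h)
    rw [card_insert_of_notMem haA, sum_insert haA, Polynomial.eval_sub, Polynomial.taylor_eval,
      add_comm (x a)]
    ring

theorem subset_sum_identity_zero (R : Type*) [CommRing R] (n : ℕ) (hn : 1 ≤ n)
    (x : Fin n → R) (y : Fin (n - 1) → R) :
    ∑ A : Finset (Fin n),
      (-1 : R) ^ (n - A.card) * ∏ i : Fin (n - 1), ((∑ a ∈ A, x a) + y i) = 0 := by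
  have hdeg : (∏ i, (Polynomial.X + Polynomial.C (y i))).degree <
      ((univ : Finset (Fin n)).card : WithBot ℕ) := by
    have hle : (∏ i, (Polynomial.X + Polynomial.C (y i))).natDegree ≤ n - 1 := by
      refine (Polynomial.natDegree_prod_le _ _).trans ?_
      simpa only [Polynomial.natDegree_add_C, sum_const, card_fin, smul_eq_mul, mul_one] using
        Nat.mul_le_mul_left (n - 1) (Polynomial.natDegree_X_le (R := R))
    refine Polynomial.degree_le_natDegree.trans_lt ?_
    rw [card_fin, Nat.cast_lt]
    omega
  have h := Polynomial.sum_powerset_neg_one_pow_card_mul_eval_sum x univ _ hdeg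
  rw [powerset_univ] at h
  rw [← mul_zero ((-1 : R) ^ n), ← h, mul_sum]
  refine sum_congr rfl fun A _ => ?_
  have hA : A.card ≤ n := card_finset_fin_le A
  have hsign : (-1 : R) ^ (n - A.card) = (-1) ^ n * (-1) ^ A.card := by
    rw [← pow_add, neg_one_pow_congr]
    grind
  simp [hsign, Polynomial.eval_prod, mul_assoc]
end

section
/- For all integers r ≥ 1 and all integers n, C_r(q) + q·Σ_{k=1}^{r-1} C_{r-k}(q) · Σ_{m=0}^{k-1} (q-1)^m · binom(k-1,m) · binom(n-2r+2k-m, k) = Σ_{m=0}^{r-1} (q-1)^m · binom(r-1,m) · binom(n-m, r-1), as an identity of polynomials in q, where for an integer a and a natural number j, binom(a,j) = a(a-1)···(a-j+1)/j! is the generalized binomial coefficient. (At q = 1 this is Jonah's formula for Catalan numbers.) -/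
open Polynomial Finset

/-- The generalized binomial coefficient `binom(a,j) = a(a-1)⋯(a-j+1)/j!` for `a : ℤ`. -/
def gchoose (a : ℤ) (j : ℕ) : ℚ :=
  (∏ i ∈ Finset.range j, ((a : ℚ) - i)) / (Nat.factorial j)

namespace PowerSeries

open scoped PowerSeries

variable {K : Type*} [Field K]

/-- Expansion of a power series in powers of the uniformizer `X * φ⁻¹`, with remainder. -/
lemma exists_expansion_X_mul_inv {φ : K⟦X⟧} (hφ : constantCoeff φ ≠ 0) (f : K⟦X⟧) (r : ℕ) :
    ∃ (a : ℕ → K) (h : K⟦X⟧),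
      f = ∑ m ∈ range r, C (a m) * (X * φ⁻¹) ^ m + (X * φ⁻¹) ^ r * h := by
  induction r with
  | zero => exact ⟨0, f, by simp⟩
  | succ r ih =>
    obtain ⟨a, h, hf⟩ := ih
    obtain ⟨g, hg⟩ := X_dvd_iff.2 (show constantCoeff (h - C (constantCoeff h)) = 0 by simp)
    refine ⟨fun m => if m = r then constantCoeff h else a m, φ * g, ?_⟩
    have hsum : ∑ m ∈ range r, C (if m = r then constantCoeff h else a m) * (X * φ⁻¹) ^ m =
        ∑ m ∈ range r, C (a m) * (X * φ⁻¹) ^ m :=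
      sum_congr rfl fun m hm => by rw [if_neg (mem_range.1 hm).ne]
    rw [sum_range_succ, hsum]
    simp only [if_true]
    have hX : X * φ⁻¹ * (φ * g) = X * g := by
      linear_combination X * g * PowerSeries.inv_mul_cancel φ hφ
    rw [pow_succ, mul_assoc ((X * φ⁻¹) ^ r), hX, ← hg]
    linear_combination hf

lemma coeff_X_mul_derivative_pow [CharZero K] (φ : K⟦X⟧) (s : ℕ) :
    coeff (s + 1) (X * (φ ^ s * d⁄dX K φ)) = coeff (s + 1) (φ ^ (s + 1)) := by
  have h : coeff s (d⁄dX K (φ ^ (s + 1))) = coeff (s + 1) (φ ^ (s + 1)) * (s + 1) :=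
    coeff_derivative _ _
  rw [derivative_pow, Nat.add_sub_cancel, mul_assoc, ← map_natCast (C (R := K)), coeff_C_mul] at h
  rw [coeff_succ_X_mul]
  have hs : ((s : K) + 1) ≠ 0 := Nat.cast_add_one_ne_zero s
  push_cast at h
  exact mul_left_cancel₀ hs (by rw [h, mul_comm])

/-- The residue computation behind Lagrange inversion. -/
lemma coeff_pow_mul_pow_mul_derivative [CharZero K] {φ : K⟦X⟧} (hφ : constantCoeff φ ≠ 0)
    (m p : ℕ) :
    coeff p (φ ^ (p + 1) * ((X * φ⁻¹) ^ m * d⁄dX K (X * φ⁻¹))) = if m = p then 1 else 0 := by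
  have hinv : φ * φ⁻¹ = 1 := PowerSeries.mul_inv_cancel φ hφ
  have hD : φ ^ 2 * d⁄dX K (X * φ⁻¹) = φ - X * d⁄dX K φ := by
    rw [Derivation.leibniz, derivative_inv', derivative_X]
    simp only [smul_eq_mul]
    linear_combination (φ - X * d⁄dX K φ * (φ * φ⁻¹ + 1)) * hinv
  have hpow (k : ℕ) : φ ^ k * φ⁻¹ ^ k = 1 := by rw [← mul_pow, hinv, one_pow]
  rcases lt_trichotomy m p with hmp | rfl | hmp
  · obtain ⟨s, rfl⟩ := Nat.exists_eq_add_of_lt hmp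
    rw [if_neg hmp.ne]
    have key : φ ^ (m + s + 1 + 1) * ((X * φ⁻¹) ^ m * d⁄dX K (X * φ⁻¹)) =
        X ^ m * (φ ^ (s + 1) - X * (φ ^ s * d⁄dX K φ)) := by
      calc _ = X ^ m * (φ ^ m * φ⁻¹ ^ m) * φ ^ s * (φ ^ 2 * d⁄dX K (X * φ⁻¹)) := by ring
        _ = _ := by rw [hpow, hD]; ring
    rw [key, show m + s + 1 = (s + 1) + m by ring, coeff_X_pow_mul, map_sub,
      coeff_X_mul_derivative_pow, sub_self]
  · rw [if_pos rfl]
    have key : φ ^ (m + 1) * ((X * φ⁻¹) ^ m * d⁄dX K (X * φ⁻¹)) =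
        X ^ m * (φ⁻¹ * (φ - X * d⁄dX K φ)) := by
      calc _ = X ^ m * (φ ^ m * φ⁻¹ ^ m) * (φ * d⁄dX K (X * φ⁻¹)) := by ring
        _ = X ^ m * ((φ * φ⁻¹) * (φ * d⁄dX K (X * φ⁻¹))) := by rw [hpow, hinv]; ring
        _ = X ^ m * (φ⁻¹ * (φ ^ 2 * d⁄dX K (X * φ⁻¹))) := by ring
        _ = _ := by rw [hD]
    have := coeff_X_pow_mul (φ⁻¹ * (φ - X * d⁄dX K φ)) m 0
    rw [zero_add] at this
    rw [key, this]
    simp [hφ]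
  · rw [if_neg hmp.ne']
    have key : φ ^ (p + 1) * ((X * φ⁻¹) ^ m * d⁄dX K (X * φ⁻¹)) =
        X ^ m * (φ ^ (p + 1) * φ⁻¹ ^ m * d⁄dX K (X * φ⁻¹)) := by ring
    rw [key, coeff_X_pow_mul', if_neg (by lia)]

/-- Lagrange inversion for a finite expansion in powers of `X * φ⁻¹`. -/
lemma lagrange_coeff [CharZero K] {φ : K⟦X⟧} (hφ : constantCoeff φ ≠ 0) {f h : K⟦X⟧} {a : ℕ → K}
    {r p : ℕ} (hp : p + 1 < r)
    (hf : f = ∑ m ∈ range r, C (a m) * (X * φ⁻¹) ^ m + (X * φ⁻¹) ^ r * h) :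
    (p + 1) * a (p + 1) = coeff p (φ ^ (p + 1) * d⁄dX K f) := by
  obtain ⟨r, rfl⟩ : ∃ s, r = s + 1 := ⟨r - 1, by lia⟩
  set u : K⟦X⟧ := X * φ⁻¹ with hu
  have hDpow (m : ℕ) : d⁄dX K (u ^ (m + 1)) = C ((m : K) + 1) * (u ^ m * d⁄dX K u) := by
    rw [derivative_pow, Nat.add_sub_cancel]
    simp [mul_assoc]
  have hD : φ ^ (p + 1) * d⁄dX K f =
      ∑ m ∈ range r, C (a (m + 1) * (m + 1)) * (φ ^ (p + 1) * (u ^ m * d⁄dX K u)) +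
        X ^ r * (φ ^ (p + 1) * φ⁻¹ ^ r * (C ((r : K) + 1) * d⁄dX K u * h + u * d⁄dX K h)) := by
    rw [hf, sum_range_succ', map_add, map_add, map_sum, mul_add, mul_add, mul_sum]
    have h0 : d⁄dX K (C (a 0) * u ^ 0) = 0 := by simp
    have hrem : d⁄dX K (u ^ (r + 1) * h) =
        u ^ r * (C ((r : K) + 1) * d⁄dX K u * h + u * d⁄dX K h) := by
      rw [Derivation.leibniz, hDpow]
      simp only [smul_eq_mul]
      ring
    rw [h0, hrem, mul_zero, add_zero]
    congr 1
    · refine sum_congr rfl fun m _ => ?_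
      rw [Derivation.leibniz, hDpow, derivative_C]
      simp only [smul_eq_mul, map_mul]
      ring
    · rw [hu]; ring
  rw [hD, map_add, map_sum, coeff_X_pow_mul', if_neg (by lia), add_zero]
  simp only [coeff_C_mul, hu, coeff_pow_mul_pow_mul_derivative hφ]
  rw [sum_eq_single p (by simp +contextual) (fun hp' => absurd (mem_range.2 (by lia)) hp')]
  simp [mul_comm]

/-- A convolution identity for the coefficients of powers of a power series, equivalent to the
Lagrange inversion formula. -/
theorem coeff_pow_mul_eq_sum [CharZero K] {φ : K⟦X⟧} (hφ : constantCoeff φ ≠ 0) (G : K⟦X⟧)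
    (r : ℕ) :
    coeff r (φ ^ (r + 1) * G) =
      ∑ m ∈ range (r + 1),
        coeff m (φ ^ (m + 1)) / (m + 1) * coeff (r - m) (φ ^ (r - m) * G) := by
  obtain ⟨a, h, ha⟩ := exists_expansion_X_mul_inv hφ X (r + 2)
  have ha0 : a 0 = 0 := by
    have := congrArg (constantCoeff (R := K)) ha
    rw [sum_range_succ'] at this
    simpa using this.symm
  have ham (m : ℕ) (hm : m ∈ range (r + 1)) : a (m + 1) = coeff m (φ ^ (m + 1)) / (m + 1) := by
    have := lagrange_coeff hφ (p := m) (by have := mem_range.1 hm; lia) ha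
    rw [derivative_X, mul_one] at this
    rw [← this, mul_div_cancel_left₀ _ (Nat.cast_add_one_ne_zero m)]
  have hpow (k : ℕ) : φ ^ k * φ⁻¹ ^ k = 1 := by
    rw [← mul_pow, PowerSeries.mul_inv_cancel φ hφ, one_pow]
  calc coeff r (φ ^ (r + 1) * G) = coeff (r + 1) (X * (φ ^ (r + 1) * G)) :=
        (coeff_succ_X_mul _ _).symm
    _ = coeff (r + 1) (∑ m ∈ range (r + 1), C (a (m + 1)) * (X ^ (m + 1) * (φ ^ (r - m) * G)) +
          X ^ (r + 2) * (φ⁻¹ ^ (r + 2) * h * (φ ^ (r + 1) * G))) := by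
        congr 1
        conv_lhs => rw [ha]
        rw [sum_range_succ', ha0, map_zero, zero_mul, add_zero, add_mul, sum_mul]
        congr 1
        · refine sum_congr rfl fun m hm => ?_
          obtain ⟨s, rfl⟩ := Nat.exists_eq_add_of_le (Nat.lt_succ_iff.1 (mem_range.1 hm))
          rw [Nat.add_sub_cancel_left]
          linear_combination C (a (m + 1)) * X ^ (m + 1) * φ ^ s * G * hpow (m + 1)
        · ring
    _ = _ := by
        rw [map_add, coeff_X_pow_mul', if_neg (by lia), add_zero, map_sum]
        refine sum_congr rfl fun m hm => ?_
        rw [coeff_C_mul, ham m hm, coeff_X_pow_mul', if_pos (by have := mem_range.1 hm; lia),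
          Nat.add_sub_add_right]

end PowerSeries

lemma choose_intCast_eq_gchoose (a : ℤ) (j : ℕ) : Ring.choose (a : ℚ) j = gchoose a j := by
  rw [Ring.choose_eq_smul, gchoose, ← Polynomial.aeval_eq_smeval, Polynomial.aeval_def,
    ← Polynomial.eval_map, descPochhammer_map, descPochhammer_eval_eq_prod_range, smul_eq_mul,
    div_eq_inv_mul]

lemma sum_gchoose_eq_coeff (q : ℚ) (b : ℤ) (k j : ℕ) :
    ∑ m ∈ range (k + 1), (q - 1) ^ m * ((k.choose m : ℚ) * gchoose (b + 2 * k - m) j) =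
      PowerSeries.coeff j (((1 + PowerSeries.X) * (PowerSeries.C q + PowerSeries.X)) ^ k *
        PowerSeries.binomialSeries ℚ (b : ℚ)) := by
  set B := PowerSeries.binomialSeries ℚ (b : ℚ) with hB
  have hterm (m : ℕ) (hm : m ∈ range (k + 1)) :
      gchoose (b + 2 * k - m) j =
        PowerSeries.coeff j (B * (1 + PowerSeries.X) ^ k * (1 + PowerSeries.X) ^ (k - m)) := by
    have hmk : m ≤ k := Nat.lt_succ_iff.1 (mem_range.1 hm)
    have hcast : ((b + 2 * k - m : ℤ) : ℚ) = (b : ℚ) + (k : ℕ) + (k - m : ℕ) := by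
      push_cast [Nat.cast_sub hmk]
      ring
    rw [← choose_intCast_eq_gchoose, hcast, hB, ← PowerSeries.binomialSeries_nat (R := ℚ) k,
      ← PowerSeries.binomialSeries_nat (R := ℚ) (k - m), ← PowerSeries.binomialSeries_add,
      ← PowerSeries.binomialSeries_add, PowerSeries.binomialSeries_coeff, smul_eq_mul, mul_one]
  have hadd : (PowerSeries.C q + PowerSeries.X : PowerSeries ℚ) =
      PowerSeries.C (q - 1) + (1 + PowerSeries.X) := by
    rw [map_sub, map_one]
    ring
  rw [mul_pow, hadd, add_pow (PowerSeries.C (q - 1)), mul_sum, sum_mul, map_sum]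
  refine sum_congr rfl fun m hm => ?_
  rw [hterm m hm, ← mul_assoc, ← PowerSeries.coeff_C_mul]
  congr 1
  rw [map_mul PowerSeries.C, map_pow, map_natCast]
  ring

lemma X_mul_narayana_eval (q : ℚ) (m : ℕ) :
    q * (narayana (m + 1)).eval q =
      PowerSeries.coeff m
        (((1 + PowerSeries.X) * (PowerSeries.C q + PowerSeries.X)) ^ (m + 1)) / (m + 1) := by
  have hpoly : ((1 + PowerSeries.X) * (PowerSeries.C q + PowerSeries.X) : PowerSeries ℚ) ^ (m + 1) =
      (((1 + X) ^ (m + 1) * (X + C q) ^ (m + 1) : ℚ[X]) : PowerSeries ℚ) := by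
    push_cast
    rw [mul_pow, add_comm PowerSeries.X]
  rw [hpoly, Polynomial.coeff_coe, Polynomial.coeff_mul, narayana, if_neg m.succ_ne_zero,
    Polynomial.eval_finsetSum, mul_sum, sum_div, Nat.sum_antidiagonal_eq_sum_range_succ_mk,
    ← Finset.Ico_add_one_right_eq_Icc, Finset.sum_Ico_eq_sum_range, Nat.add_sub_cancel]
  refine sum_congr rfl fun i hi => ?_
  have him : i ≤ m := Nat.lt_succ_iff.1 (mem_range.1 hi)
  rw [Polynomial.coeff_one_add_X_pow, Polynomial.coeff_X_add_C_pow,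
    show m + 1 - (m - i) = i + 1 by lia, Nat.add_sub_cancel_left, add_comm 1 i,
    Nat.choose_symm_of_eq_add (show m + 1 = (m - i) + (i + 1) by lia)]
  simp only [Polynomial.eval_mul, Polynomial.eval_C, Polynomial.eval_pow, Polynomial.eval_X]
  push_cast
  ring

/-- First generalization of Jonah's formula to Narayana polynomials. -/
theorem narayana_jonah_first (r : ℕ) (hr : 1 ≤ r) (n : ℤ) :
    narayana r +
      Polynomial.X * ∑ k ∈ Finset.Icc 1 (r - 1),
        narayana (r - k) *
          ∑ m ∈ Finset.range k,
            (Polynomial.X - 1) ^ m *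
              Polynomial.C (((k - 1).choose m : ℚ) * gchoose (n - 2 * r + 2 * k - m) k) =
      ∑ m ∈ Finset.range r,
        (Polynomial.X - 1) ^ m *
          Polynomial.C (((r - 1).choose m : ℚ) * gchoose (n - m) (r - 1)) := by
  obtain ⟨r, rfl⟩ : ∃ s, r = s + 1 := ⟨r - 1, by lia⟩
  refine Polynomial.eq_of_infinite_eval_eq _ _
    ((Set.finite_singleton (0 : ℚ)).infinite_compl.mono fun q hq => ?_)
  have hq0 : q ≠ 0 := hq
  rw [Set.mem_ofPred_eq]
  set φ : PowerSeries ℚ := (1 + PowerSeries.X) * (PowerSeries.C q + PowerSeries.X) with hφdef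
  have hφ0 : PowerSeries.constantCoeff φ = q := by simp [hφdef]
  have hφ : PowerSeries.constantCoeff φ ≠ 0 := hφ0.symm ▸ hq0
  have hinv : φ * φ⁻¹ = 1 := PowerSeries.mul_inv_cancel φ hφ
  set b : ℤ := n - 2 * r with hb
  set B := PowerSeries.binomialSeries ℚ (b : ℚ) with hB
  have hrhs : ∑ m ∈ range (r + 1), (q - 1) ^ m * ((r.choose m : ℚ) * gchoose (n - m) r) =
      PowerSeries.coeff r (φ ^ r * B) := by
    rw [← sum_gchoose_eq_coeff, hb, sub_add_cancel]
  have hinner (k : ℕ) :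
      ∑ m ∈ range (k + 1), (q - 1) ^ m *
          ((k.choose m : ℚ) * gchoose (n - 2 * (r + 1 : ℕ) + 2 * (k + 1 : ℕ) - m) (k + 1)) =
        PowerSeries.coeff (k + 1) (φ ^ k * B) := by
    rw [← sum_gchoose_eq_coeff, hb]
    refine sum_congr rfl fun m _ => ?_
    congr 3
    push_cast
    ring
  have hmain := PowerSeries.coeff_pow_mul_eq_sum hφ (φ⁻¹ * B) r
  have hlhs : φ ^ (r + 1) * (φ⁻¹ * B) = φ ^ r * B := by
    linear_combination φ ^ r * B * hinv
  have hconst : PowerSeries.coeff 0 (φ⁻¹ * B) = q⁻¹ := by simp [hφ0, hB]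
  rw [hlhs, ← Finset.sum_range_reflect, Finset.sum_range_succ'] at hmain
  simp only [Nat.add_sub_cancel, Nat.sub_zero, Nat.sub_self, pow_zero, one_mul,
    ← X_mul_narayana_eval, hφdef] at hmain
  rw [← hφdef] at hmain
  rw [← Finset.Ico_add_one_right_eq_Icc, Finset.sum_Ico_eq_sum_range]
  simp only [Polynomial.eval_add, Polynomial.eval_mul, Polynomial.eval_finsetSum,
    Polynomial.eval_pow, Polynomial.eval_sub, Polynomial.eval_X, Polynomial.eval_one,
    Polynomial.eval_C, Nat.add_sub_cancel, hrhs, hinner,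
    add_comm 1]
  rw [hmain, hconst, mul_sum, mul_right_comm, mul_inv_cancel₀ hq0, one_mul, add_comm]
  congr 1
  refine sum_congr rfl fun k hk => ?_
  obtain ⟨s, rfl⟩ : ∃ s, r = k + 1 + s := Nat.exists_eq_add_of_le (mem_range.1 hk)
  rw [Nat.add_sub_cancel_left, Nat.add_sub_cancel, show k + 1 + s + 1 - (k + 1) = s + 1 by lia,
    show φ ^ (k + 1) * (φ⁻¹ * B) = φ ^ k * B by linear_combination φ ^ k * B * hinv, mul_assoc]
end

section
/- Define p_r(q) = Σ_{k=0}^{r-1} binom(r-1,k)·binom(r,k)·q^k for r ≥ 1. Then for every integer n ≥ 1, n·C_n(q) = Σ_{r=1}^{n} p_r(q)·C_{n-r}(q), as an identity of polynomials in q. (Thus p_r(q) is the r-th Newton power sum of the alphabet A defined by h_n(A) = C_n(q); in particular each p_r(q) has positive integer coefficients, and p_r(1) = binom(2r-1, r-1).) -/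
open Polynomial Finset

/-- The power sum `p_r(q) = ∑_{k=0}^{r-1} binom(r-1,k)·binom(r,k)·q^k` of the
Narayana alphabet. -/
noncomputable def narayanaPowerSum (r : ℕ) : Polynomial ℚ :=
  ∑ k ∈ Finset.range r,
    Polynomial.C (((r - 1).choose k * r.choose k : ℚ)) * Polynomial.X ^ k

/-- The square binomial polynomial `∑ k, binom(n,k)² q^k`. -/
noncomputable def squareBinomial (n : ℕ) : ℚ[X] :=
  ∑ k ∈ range (n + 1), C ((n.choose k : ℚ) ^ 2) * X ^ k

/-- The polynomial `∑ k, binom(n,k) binom(n,k+1) q^k`. -/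
noncomputable def adjacentBinomial (n : ℕ) : ℚ[X] :=
  ∑ k ∈ range n, C ((n.choose k : ℚ) * n.choose (k + 1)) * X ^ k

lemma coeff_squareBinomial (n k : ℕ) :
    (squareBinomial n).coeff k = (n.choose k : ℚ) ^ 2 := by
  simp only [squareBinomial, finsetSum_coeff, coeff_C_mul_X_pow, sum_ite_eq, mem_range]
  split_ifs with h
  · rfl
  · simp [Nat.choose_eq_zero_of_lt (show n < k by omega)]

lemma coeff_adjacentBinomial (n k : ℕ) :
    (adjacentBinomial n).coeff k = (n.choose k : ℚ) * n.choose (k + 1) := by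
  simp only [adjacentBinomial, finsetSum_coeff, coeff_C_mul_X_pow, sum_ite_eq, mem_range]
  split_ifs with h
  · rfl
  · simp [Nat.choose_eq_zero_of_lt (show n < k + 1 by omega)]

lemma coeff_narayanaPowerSum_succ (n k : ℕ) :
    (narayanaPowerSum (n + 1)).coeff k = (n.choose k : ℚ) * (n + 1).choose k := by
  simp only [narayanaPowerSum, finsetSum_coeff, coeff_C_mul_X_pow, sum_ite_eq, mem_range]
  split_ifs with h
  · simp
  · simp [Nat.choose_eq_zero_of_lt (show n < k by omega)]

lemma natCast_mul_narayana (n : ℕ) : (n : ℚ[X]) * narayana n = adjacentBinomial n := by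
  rcases Nat.eq_zero_or_pos n with rfl | hn
  · simp [adjacentBinomial]
  have hn' : (n : ℚ) ≠ 0 := by positivity
  rw [narayana, if_neg hn.ne', adjacentBinomial, ← Finset.Ico_add_one_right_eq_Icc,
    Finset.sum_Ico_eq_sum_range, mul_sum]
  refine sum_congr (by simp) fun k _ => ?_
  rw [← mul_assoc, ← map_natCast (C : ℚ →+* ℚ[X]), ← C_mul]
  simp only [add_comm 1 k, Nat.add_sub_cancel]
  rw [mul_div_cancel₀ _ hn']

lemma squareBinomial_zero : squareBinomial 0 = 1 := by simp [squareBinomial]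

lemma adjacentBinomial_zero : adjacentBinomial 0 = 0 := by simp [adjacentBinomial]

lemma squareBinomial_succ (n : ℕ) :
    squareBinomial (n + 1) = (1 + X) * squareBinomial n + 2 * X * adjacentBinomial n := by
  rw [show (1 + X) * squareBinomial n + 2 * X * adjacentBinomial n =
    squareBinomial n + X * (squareBinomial n + 2 * adjacentBinomial n) by ring]
  ext k
  cases k with
  | zero => simp [coeff_squareBinomial]
  | succ k =>
    simp only [coeff_add, coeff_X_mul, coeff_ofNat_mul, coeff_squareBinomial,
      coeff_adjacentBinomial, Nat.choose_succ_succ']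
    push_cast
    ring

lemma narayanaPowerSum_succ (n : ℕ) :
    narayanaPowerSum (n + 1) = squareBinomial n + X * adjacentBinomial n := by
  ext k
  cases k with
  | zero => simp [coeff_squareBinomial, coeff_narayanaPowerSum_succ]
  | succ k =>
    simp only [coeff_add, coeff_X_mul, coeff_squareBinomial, coeff_narayanaPowerSum_succ,
      coeff_adjacentBinomial, Nat.choose_succ_succ']
    push_cast
    ring

lemma choose_succ_mul_succ_cast (m k : ℕ) :
    ((k : ℚ) + 1) * m.choose (k + 1) = (m - k) * m.choose k := by
  rcases le_or_gt k m with h | h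
  · have := Nat.choose_succ_right_eq m k
    rw [← Nat.cast_sub h, mul_comm, mul_comm (_ : ℚ) (m.choose k : ℚ)]
    exact_mod_cast this
  · simp [Nat.choose_eq_zero_of_lt h, Nat.choose_eq_zero_of_lt (h.trans (Nat.lt_succ_self k))]

/-- A contiguity relation for `squareBinomial`, equivalent to the three-term Legendre recurrence. -/
lemma squareBinomial_contiguous (m : ℕ) :
    (m + 1 : ℚ[X]) * (1 - X) ^ 2 * squareBinomial m =
      (m + 1 : ℚ[X]) * (1 + X) * squareBinomial (m + 1) -
        2 * (m + 2 : ℚ[X]) * X * adjacentBinomial (m + 1) := by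
  set L := squareBinomial m with hL
  set L' := squareBinomial (m + 1) with hL'
  set M := adjacentBinomial (m + 1) with hM
  have key : ((m + 1 : ℕ) : ℚ[X]) * (L + X * (X * L)) + ((2 * (m + 2) : ℕ) : ℚ[X]) * (X * M) =
      ((m + 1 : ℕ) : ℚ[X]) * (L' + X * (L' + 2 * L)) := by
    ext k
    rcases k with _ | _ | k
    · simp [hL, hL', coeff_squareBinomial]
    · simp only [coeff_add, coeff_X_mul, coeff_natCast_mul, coeff_ofNat_mul, hL, hL', hM,
        coeff_squareBinomial, coeff_adjacentBinomial, zero_add, mul_coeff_zero, coeff_X_zero]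
      simp
      ring
    · simp only [coeff_add, coeff_X_mul, coeff_natCast_mul, coeff_ofNat_mul, hL, hL', hM,
        coeff_squareBinomial, coeff_adjacentBinomial, Nat.choose_succ_succ']
      have h₁ := choose_succ_mul_succ_cast m k
      have h₂ := choose_succ_mul_succ_cast m (k + 1)
      push_cast at h₁ h₂ ⊢
      generalize (m.choose k : ℚ) = y at *
      generalize (m.choose (k + 1) : ℚ) = u at *
      generalize (m.choose (k + 1 + 1) : ℚ) = x at *
      linear_combination 2 * (y + u) * h₂ - 2 * (x + u) * h₁
  push_cast at key
  linear_combination key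

open PowerSeries in
/-- Newton's identity in generating function form. -/
lemma mk_narayanaPowerSum_mul_mk_narayana :
    (PowerSeries.mk narayanaPowerSum) * PowerSeries.mk narayana =
      PowerSeries.X * d⁄dX ℚ[X] (PowerSeries.mk narayana) := by
  set T : PowerSeries ℚ[X] := PowerSeries.X with hT
  set q : PowerSeries ℚ[X] := PowerSeries.C Polynomial.X with hq
  set L : PowerSeries ℚ[X] := PowerSeries.mk squareBinomial with hL
  set N : PowerSeries ℚ[X] := PowerSeries.mk narayana with hN
  set P : PowerSeries ℚ[X] := PowerSeries.mk narayanaPowerSum with hP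
  have hODE : d⁄dX ℚ[X] L + T * (T * (PowerSeries.C ((1 - Polynomial.X) ^ 2) * d⁄dX ℚ[X] L))
      + T * (PowerSeries.C ((1 - Polynomial.X) ^ 2) * L) =
      PowerSeries.C (1 + Polynomial.X) * L +
        T * (PowerSeries.C (2 * (1 + Polynomial.X)) * d⁄dX ℚ[X] L) := by
    ext1 n
    rcases n with _ | _ | n
    · simp only [LinearMap.map_add, PowerSeries.coeff_zero_X_mul, hT, PowerSeries.coeff_C_mul,
        PowerSeries.coeff_derivative, hL, PowerSeries.coeff_mk, squareBinomial_succ,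
        squareBinomial_zero, adjacentBinomial_zero]
      simp
    · have h₁ := squareBinomial_succ 1
      have h₂ := squareBinomial_contiguous 0
      simp only [LinearMap.map_add, PowerSeries.coeff_succ_X_mul, PowerSeries.coeff_zero_X_mul,
        hT, PowerSeries.coeff_C_mul, PowerSeries.coeff_derivative, hL, PowerSeries.coeff_mk]
      push_cast at h₁ h₂ ⊢
      linear_combination 2 * h₁ + h₂
    · have h₁ := squareBinomial_succ (n + 2)
      have h₂ := squareBinomial_contiguous (n + 1)
      simp only [LinearMap.map_add, PowerSeries.coeff_succ_X_mul, hT, PowerSeries.coeff_C_mul,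
        PowerSeries.coeff_derivative, hL, PowerSeries.coeff_mk]
      push_cast at h₁ h₂ ⊢
      linear_combination (n + 3 : ℚ[X]) * h₁ + h₂
  have hS : T * (PowerSeries.C (2 * Polynomial.X) * N) + L
      + T * (T * (PowerSeries.C ((1 - Polynomial.X) ^ 2) * L)) +
        T * PowerSeries.C (1 - Polynomial.X) =
      1 + T * (PowerSeries.C (2 * (1 + Polynomial.X)) * L) := by
    ext1 n
    rcases n with _ | _ | n
    · simp [hT, hL, squareBinomial_zero]
    · simp [hT, hL, hN, PowerSeries.coeff_succ_X_mul, squareBinomial_succ, squareBinomial_zero,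
        adjacentBinomial_zero, narayana]
      ring
    · have h₀ := natCast_mul_narayana (n + 1)
      have h₁ := squareBinomial_succ (n + 1)
      have h₂ := squareBinomial_contiguous n
      simp only [LinearMap.map_add, PowerSeries.coeff_succ_X_mul, hT, PowerSeries.coeff_C_mul, hN,
        hL, PowerSeries.coeff_mk, PowerSeries.coeff_C, PowerSeries.coeff_one]
      push_cast at h₀ h₁ h₂ ⊢
      have hn : (n + 1 : ℚ[X]) ≠ 0 := by exact_mod_cast Nat.succ_ne_zero n
      apply mul_left_cancel₀ hn
      linear_combination (n + 1 : ℚ[X]) * h₁ + h₂ + 2 * Polynomial.X * h₀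
  have hPL : PowerSeries.C 2 * P + 1 = L + T * (PowerSeries.C (1 - Polynomial.X) * L) := by
    ext1 n
    rcases n with _ | n
    · simp [hT, hL, hP, squareBinomial_zero, narayanaPowerSum]
    · simp only [map_add, PowerSeries.coeff_succ_X_mul, hT, PowerSeries.coeff_C_mul, hP,
        hL, PowerSeries.coeff_mk, PowerSeries.coeff_one, narayanaPowerSum_succ,
        squareBinomial_succ]
      simp
      ring
  simp only [map_mul, map_pow, map_sub, map_add, map_one, map_ofNat, ← hq] at hODE hS hPL
  set δ := d⁄dX ℚ[X] with hδ
  have hδT : δ T = 1 := PowerSeries.derivative_X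
  have hδq : δ q = 0 := PowerSeries.derivative_C
  have hδ_nat (m : ℕ) : δ (m : PowerSeries ℚ[X]) = 0 := by
    rw [← map_natCast (PowerSeries.C : ℚ[X] →+* PowerSeries ℚ[X]), hδ]
    exact PowerSeries.derivative_C
  have hδ2 : δ 2 = 0 := hδ_nat 2
  have hS' := congrArg δ hS
  simp only [map_add, map_sub, Derivation.leibniz, Derivation.leibniz_pow,
    Derivation.map_one_eq_zero, hδT, hδq, hδ2, smul_eq_mul] at hS'
  have h1 : L * ((1 - 2 * (1 + q) * T + (1 - q) ^ 2 * T ^ 2) * L) = 1 := by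
    apply PowerSeries.derivative.ext
    · simp only [← hδ, map_add, map_sub, Derivation.leibniz, Derivation.leibniz_pow,
        Derivation.map_one_eq_zero, hδT, hδq, hδ2, smul_eq_mul]
      simp
      linear_combination 2 * L * hODE
    · simp [hT, hL, squareBinomial_zero]
  have hTq : 4 * q * T ≠ 0 := by
    have h4 : (4 : PowerSeries ℚ[X]) ≠ 0 := by
      have h4' : (4 : ℚ[X]) ≠ 0 := by exact_mod_cast Nat.succ_ne_zero 3
      rw [← map_ofNat (PowerSeries.C : ℚ[X] →+* PowerSeries ℚ[X]) 4]
      exact (map_ne_zero_iff _ PowerSeries.C_injective).2 h4'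
    refine mul_ne_zero (mul_ne_zero h4 ?_) PowerSeries.X_ne_zero
    exact (map_ne_zero_iff _ PowerSeries.C_injective).2 Polynomial.X_ne_zero
  apply mul_left_cancel₀ hTq
  simp only [nsmul_eq_mul] at hS'
  linear_combination (2 * q * T * N) * hPL + ((1 + (1 - q) * T) * L - 1) * hS
    - (1 + (1 - q) * T) * h1 - 2 * T * hS' + 2 * hS + 2 * T * hODE

/-- Newton's identity `n·h_n = ∑_{r=1}^n p_r·h_{n-r}` for the Narayana alphabet. -/
theorem narayana_newton (n : ℕ) (hn : 1 ≤ n) :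
    (n : ℚ) • narayana n =
      ∑ r ∈ Finset.Icc 1 n, narayanaPowerSum r * narayana (n - r) := by
  have h := congrArg (PowerSeries.coeff n) mk_narayanaPowerSum_mul_mk_narayana
  obtain ⟨m, rfl⟩ := Nat.exists_eq_add_of_le' hn
  rw [PowerSeries.coeff_mul, PowerSeries.coeff_succ_X_mul, PowerSeries.coeff_derivative,
    Finset.Nat.sum_antidiagonal_eq_sum_range_succ_mk, Finset.sum_range_succ'] at h
  simp only [PowerSeries.coeff_mk] at h
  rw [← Finset.Ico_add_one_right_eq_Icc, Finset.sum_Ico_eq_sum_range]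
  simp only [add_comm 1, Nat.add_sub_cancel, Nat.cast_smul_eq_nsmul, nsmul_eq_mul]
  rw [show narayanaPowerSum 0 = 0 by simp [narayanaPowerSum]] at h
  rw [zero_mul, add_zero] at h
  rw [h]
  push_cast
  ring
end
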